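/- arXiv:2104.00105 — 2 statements merged into one kernel-verified Lean document; each statement's English description precedes it below -/
import Mathlib

section
/- Let F ∈ 𝒜 with ∫_ℝ F(x) dx = 1, and for 0 < δ ≤ 1 let F_δ(x) = δ⁻¹·F(x/δ) and f_δ be the periodization of F_δ. Then sup_{0 < δ ≤ 1} δ·‖𝓗(f_δ)‖_{L∞(ℝ/ℤ)} = max{‖𝓗(F)‖_{L∞(ℝ)}, ‖𝓗(f_1)‖_{L∞(ℝ/ℤ)}}. -/
open MeasureTheory

/-- `e t = e^{2πit}`. -/
noncomputable def e (t : ℝ) : ℂ := Complex.exp (2 * Real.pi * Complex.I * t)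

/-- Fourier transform `F̂(t) = ∫ F(x) e^{-2πitx} dx`. -/
noncomputable def FT (F : ℝ → ℝ) (t : ℝ) : ℂ :=
  ∫ x : ℝ, (F x : ℂ) * Complex.exp (-(2 * Real.pi * Complex.I) * t * x)

/-- Hilbert transform on `ℝ` via the multiplier `-i sgn(t)` and Fourier inversion. -/
noncomputable def HilbR (F : ℝ → ℝ) (x : ℝ) : ℂ :=
  ∫ t : ℝ, -Complex.I * (Real.sign t : ℂ) * FT F t * Complex.exp (2 * Real.pi * Complex.I * t * x)

/-- Hilbert transform on `ℝ/ℤ` of the periodization of `F_δ`, via the multiplier `-i sgn(k)`. -/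
noncomputable def HilbPer (F : ℝ → ℝ) (δ : ℝ) (θ : ℝ) : ℂ :=
  ∑' k : ℤ, -Complex.I * (Int.sign k : ℂ) * FT F (δ * k) *
    Complex.exp (2 * Real.pi * Complex.I * k * θ)

/-- The class `𝒜`: even, continuous, nonnegative, supported in `[-1/2,1/2]`, with `F̂ ∈ L¹`. -/
def memA (F : ℝ → ℝ) : Prop :=
  Continuous F ∧ (∀ x, F (-x) = F x) ∧ (∀ x, 0 ≤ F x) ∧
    (∀ x : ℝ, x ∉ Set.Icc (-(1/2) : ℝ) (1/2) → F x = 0) ∧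
    MeasureTheory.Integrable (FT F)

/-- `‖𝓗(F)‖_{L^∞(ℝ)}` (sup norm of a bounded continuous function). -/
noncomputable def supHR (F : ℝ → ℝ) : ℝ := ⨆ x : ℝ, ‖HilbR F x‖

/-- `‖𝓗(f_δ)‖_{L^∞(ℝ/ℤ)}` (sup norm of a bounded continuous function). -/
noncomputable def supHPer (F : ℝ → ℝ) (δ : ℝ) : ℝ := ⨆ θ : ℝ, ‖HilbPer F δ θ‖

/-- `𝒞(F) = max{‖𝓗(F)‖_{L∞(ℝ)}, ‖𝓗(f_F)‖_{L∞(ℝ/ℤ)}}`. -/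
noncomputable def CF (F : ℝ → ℝ) : ℝ := max (supHR F) (supHPer F 1)

section Part1
open FourierTransform

lemma summable_g (δ : ℝ) (hδ : 0 < δ) : Summable (fun j : ℤ => 1 / (1 + (δ * j)^2)) := by
  have h1 : Summable (fun n : ℤ => 1 / (n : ℝ)^2) := Real.summable_one_div_int_pow.2 (by norm_num)
  have h2 : Summable (fun n : ℤ => if n = 0 then (1:ℝ) else 0) :=
    (hasSum_ite_eq 0 (1:ℝ)).summable
  refine Summable.of_nonneg_of_le (fun j => by positivity) (fun j => ?_) ((h1.mul_left (1/δ^2)).add h2)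
  by_cases hj : j = 0
  · simp [hj]
  · have hj' : (j:ℝ) ≠ 0 := by exact_mod_cast hj
    have : 0 < (j:ℝ)^2 := by positivity
    simp only [hj, if_false, add_zero]
    rw [div_mul_div_comm, one_mul]
    apply one_div_le_one_div_of_le (by positivity)
    nlinarith

lemma unif_bound (δ : ℝ) (hδ : 0 < δ) : ∃ B : ℝ, ∀ (t : ℝ) (s : Finset ℤ),
    ∑ k ∈ s, 1 / (1 + (t - δ * k)^2) ≤ B := by
  refine ⟨∑' j : ℤ, 2 * (1 + δ^2) * (1 / (1 + (δ * j)^2)), fun t s => ?_⟩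
  have hs := (summable_g δ hδ).mul_left (2 * (1 + δ^2))
  set m := ⌊t / δ⌋ with hm
  set r := t - δ * m with hr
  have h0 : 0 ≤ r := by
    have := Int.floor_le (t/δ)
    rw [← hm, le_div_iff₀ hδ] at this
    linarith
  have h1 : r ≤ δ := by
    have := Int.lt_floor_add_one (t/δ)
    rw [← hm, div_lt_iff₀ hδ] at this
    linarith
  have hs2 := (Equiv.subRight m).summable_iff.2 hs
  have e2 := (Equiv.subRight m).tsum_eq (fun j : ℤ => 2 * (1 + δ^2) * (1 / (1 + (δ * j)^2)))
  rw [← e2]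
  refine le_trans (Finset.sum_le_sum (fun k _ => ?_)) (hs2.sum_le_tsum s (fun j _ => by
    positivity))
  simp only [Equiv.subRight_apply]
  push_cast
  rw [mul_one_div, div_le_div_iff₀ (by positivity) (by positivity)]
  have : t - δ * k = r - δ * (k - m) := by rw [hr]; ring
  rw [this]
  set a := δ * ((k:ℝ) - m)
  have hr2 : r^2 ≤ δ^2 := by nlinarith
  nlinarith [sq_nonneg (2*r - a), sq_nonneg (r-a), mul_nonneg (sq_nonneg δ) (sq_nonneg (r-a))]

lemma exists_rho : ∃ ρ : SchwartzMap ℝ ℂ, ∀ x ∈ Set.Icc (-(1/2) : ℝ) (1/2),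
    ∫ τ : ℝ, ρ τ * Complex.exp (-(2 * Real.pi * Complex.I) * τ * x) = 1 := by
  let φ : ContDiffBump (0:ℝ) := ⟨1, 2, by norm_num, by norm_num⟩
  have hc : HasCompactSupport (fun x : ℝ => ((φ x : ℝ) : ℂ)) :=
    φ.hasCompactSupport.comp_left (g := fun r : ℝ => (r:ℂ)) (by simp)
  have hd : ContDiff ℝ ((⊤:ℕ∞) : WithTop ℕ∞) (fun x : ℝ => ((φ x : ℝ) : ℂ)) :=
    Complex.ofRealCLM.contDiff.comp φ.contDiff
  let ψ : SchwartzMap ℝ ℂ := hc.toSchwartzMap hd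
  refine ⟨𝓕⁻ ψ, fun x hx => ?_⟩
  have h1 : 𝓕 (𝓕⁻ ψ) = ψ := FourierTransform.fourier_fourierInv_eq ψ
  have h2 : ψ x = 1 := by
    change ((φ x : ℝ) : ℂ) = 1
    rw [φ.one_of_mem_closedBall]
    · simp
    · simp only [Metric.mem_closedBall, dist_zero_right, Real.norm_eq_abs]
      change |x| ≤ 1
      rw [abs_le]; constructor <;> linarith [hx.1, hx.2]
  have h3 : (𝓕 (𝓕⁻ ψ)) x = 1 := by rw [h1, h2]
  rw [SchwartzMap.fourier_coe, Real.fourier_eq'] at h3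
  rw [← h3]
  congr 1
  ext τ
  rw [smul_eq_mul, mul_comm]
  congr 2
  simp
  ring

lemma FT_repr (F : ℝ → ℝ) (hF : memA F) : ∃ ρ : SchwartzMap ℝ ℂ, ∀ s : ℝ,
    FT F s = ∫ t : ℝ, ρ (t - s) * FT F t := by
  obtain ⟨hc, hev, hnn, hsupp, hint⟩ := hF
  obtain ⟨ρ, hρ⟩ := exists_rho
  refine ⟨ρ, fun s => ?_⟩
  have hFi : Integrable F := by
    apply hc.integrable_of_hasCompactSupport
    exact HasCompactSupport.intro isCompact_Icc hsupp
  have hFc : Integrable (fun x => (F x : ℂ)) := hFi.ofReal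
  have h1 : FT F s = ∫ x : ℝ, ∫ τ : ℝ, (F x : ℂ) * ρ τ *
      Complex.exp (-(2 * Real.pi * Complex.I) * (s + τ) * x) := by
    unfold FT
    congr 1
    ext x
    have : ∀ τ : ℝ, (F x : ℂ) * ρ τ * Complex.exp (-(2 * Real.pi * Complex.I) * (s + τ) * x)
      = (F x : ℂ) * Complex.exp (-(2 * Real.pi * Complex.I) * s * x) *
        (ρ τ * Complex.exp (-(2 * Real.pi * Complex.I) * τ * x)) := by
      intro τ
      rw [show (-(2 * Real.pi * Complex.I) * (s + τ) * x : ℂ) =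
        -(2 * Real.pi * Complex.I) * s * x + -(2 * Real.pi * Complex.I) * τ * x by ring, Complex.exp_add]
      ring
    simp_rw [this]
    rw [integral_const_mul]
    by_cases hx : x ∈ Set.Icc (-(1/2) : ℝ) (1/2)
    · rw [hρ x hx, mul_one]
    · rw [hsupp x hx]; simp
  have hI : Integrable (Function.uncurry (fun x τ : ℝ => (F x : ℂ) * ρ τ *
      Complex.exp (-(2 * Real.pi * Complex.I) * (s + τ) * x))) (volume.prod volume) := by
    have h := hFc.mul_prod ρ.integrable (μ := volume) (ν := volume)
    refine h.mul_bdd (c := 1) ?_ ?_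
    · apply Continuous.aestronglyMeasurable
      fun_prop
    · refine Filter.Eventually.of_forall (fun p => ?_)
      rw [Complex.norm_exp]
      simp
  rw [h1, integral_integral_swap hI]
  rw [← integral_sub_right_eq_self _ s]
  congr 1
  ext t
  have : ∀ x : ℝ, (F x : ℂ) * ρ (t - s) * Complex.exp (-(2 * Real.pi * Complex.I) * (s + (t - s : ℝ)) * x)
    = ρ (t - s) * ((F x : ℂ) * Complex.exp (-(2 * Real.pi * Complex.I) * t * x)) := by
    intro x
    push_cast
    rw [add_sub_cancel]; ring
  simp_rw [this]
  rw [integral_const_mul]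
  rfl

lemma schwartz_decay (ρ : SchwartzMap ℝ ℂ) : ∃ C : ℝ, 0 ≤ C ∧ ∀ x, ‖ρ x‖ ≤ C * (1 / (1 + x^2)) := by
  obtain ⟨C0, h0⟩ := ρ.decay 0 0
  obtain ⟨C2, h2⟩ := ρ.decay 2 0
  simp only [norm_iteratedFDeriv_zero, pow_zero, one_mul, Real.norm_eq_abs, sq_abs] at h0 h2
  refine ⟨C0 + C2, ?_, fun x => ?_⟩
  · have := h0.2 0
    have := h2.2 0
    linarith [h0.1, h2.1]
  · rw [mul_one_div, le_div_iff₀ (by positivity)]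
    nlinarith [h0.2 x, h2.2 x]

lemma summable_FT (F : ℝ → ℝ) (hF : memA F) (δ : ℝ) (hδ : 0 < δ) :
    Summable (fun k : ℤ => ‖FT F (δ * k)‖) := by
  obtain ⟨ρ, hρ⟩ := FT_repr F hF
  obtain ⟨C, hC0, hC⟩ := schwartz_decay ρ
  obtain ⟨B, hB⟩ := unif_bound δ hδ
  have hint : Integrable (FT F) := hF.2.2.2.2
  refine summable_of_sum_le (c := ∫ t, C * B * ‖FT F t‖) (fun k => norm_nonneg _) (fun s => ?_)
  have hi : ∀ k : ℤ, Integrable (fun t => C * (1 / (1 + (t - δ * k)^2)) * ‖FT F t‖) := by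
    intro k
    refine hint.norm.bdd_mul (c := C) ?_ ?_
    · apply Continuous.aestronglyMeasurable
      refine continuous_const.mul (continuous_const.div (by fun_prop) (fun x => by positivity))
    · refine Filter.Eventually.of_forall (fun t => ?_)
      rw [Real.norm_of_nonneg (by positivity)]
      apply mul_le_of_le_one_right hC0
      rw [div_le_one (by positivity)]
      nlinarith [sq_nonneg (t - δ * k)]
  calc ∑ k ∈ s, ‖FT F (δ * k)‖ ≤ ∑ k ∈ s, ∫ t, C * (1 / (1 + (t - δ * k)^2)) * ‖FT F t‖ := by
        refine Finset.sum_le_sum (fun k _ => ?_)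
        rw [hρ]
        refine norm_integral_le_of_norm_le (hi k) (Filter.Eventually.of_forall (fun t => ?_))
        rw [norm_mul]
        exact mul_le_mul_of_nonneg_right (hC _) (norm_nonneg _)
    _ = ∫ t, ∑ k ∈ s, C * (1 / (1 + (t - δ * k)^2)) * ‖FT F t‖ :=
        (integral_finsetSum s (fun k _ => hi k)).symm
    _ ≤ _ := by
        refine integral_mono (integrable_finsetSum s (fun k _ => hi k)) (hint.norm.const_mul _) (fun t => ?_)
        simp only
        rw [← Finset.sum_mul, ← Finset.mul_sum]
        gcongr
        exact hB t s

end Part1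
section Part2

noncomputable def kk (w : ℂ) : ℂ := ∑' n : ℕ, -(2 * w) / (((n:ℂ) + 1)^2 - w^2)

noncomputable def kr (u : ℝ) : ℝ := ∑' n : ℕ, (2 * u) / (((n:ℝ) + 1)^2 - u^2)

noncomputable def kbd (ρ : ℝ) (n : ℕ) : ℝ := 2 / (((n:ℝ) + 1)^2 - ρ^2)

lemma kden_pos {ρ : ℝ} (h0 : 0 ≤ ρ) (h1 : ρ < 1) (n : ℕ) : 0 < ((n:ℝ) + 1)^2 - ρ^2 := by
  have : (0:ℝ) ≤ n := n.cast_nonneg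
  nlinarith

lemma kbd_summable {ρ : ℝ} (h0 : 0 ≤ ρ) (h1 : ρ < 1) : Summable (kbd ρ) := by
  have h : Summable (fun n : ℕ => 1 / ((n + 1 : ℕ) : ℝ)^2) :=
    (summable_nat_add_iff (f := fun n : ℕ => 1 / (n : ℝ)^2) 1).2
      (Real.summable_one_div_nat_pow.2 (by norm_num))
  have hp : 0 < 1 - ρ^2 := by nlinarith
  refine Summable.of_nonneg_of_le (fun n => ?_) (fun n => ?_) (h.mul_left (2 / (1 - ρ^2)))
  · have := kden_pos h0 h1 n
    unfold kbd; positivity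
  · unfold kbd
    rw [div_mul_div_comm, mul_one]
    push_cast
    have : (0:ℝ) ≤ n := n.cast_nonneg
    apply div_le_div_of_nonneg_left (by norm_num) (by positivity)
    nlinarith [mul_nonneg (sq_nonneg ρ) this, mul_nonneg (sq_nonneg ρ) (sq_nonneg (n:ℝ))]

lemma kterm_bound {ρ : ℝ} (h0 : 0 ≤ ρ) (h1 : ρ < 1) (w : ℂ) (hw : ‖w‖ ≤ ρ) (n : ℕ) :
    ‖-(2 * w) / (((n:ℂ) + 1)^2 - w^2)‖ ≤ kbd ρ n := by
  unfold kbd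
  rw [norm_div, norm_neg, norm_mul]
  have h3 := kden_pos h0 h1 n
  have h4 : ((n:ℝ) + 1)^2 - ρ^2 ≤ ‖((n:ℂ) + 1)^2 - w^2‖ := by
    have h := norm_sub_norm_le (((n:ℂ) + 1)^2) (w^2)
    have e : ‖((n:ℂ) + 1)^2‖ = ((n:ℝ)+1)^2 := by
      rw [norm_pow]; congr 1
      have : ((n:ℂ)+1) = (((n:ℝ)+1 : ℝ) : ℂ) := by push_cast; rfl
      rw [this, Complex.norm_real, Real.norm_of_nonneg (by positivity)]
    rw [e, norm_pow] at h
    have : ‖w‖^2 ≤ ρ^2 := by gcongr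
    linarith
  have h5 : ‖(2:ℂ)‖ * ‖w‖ ≤ 2 := by
    simp only [Complex.norm_ofNat]; linarith
  exact div_le_div₀ (by norm_num) h5 h3 h4

lemma kk_bound {ρ : ℝ} (h0 : 0 ≤ ρ) (h1 : ρ < 1) (w : ℂ) (hw : ‖w‖ ≤ ρ) :
    ‖kk w‖ ≤ ∑' n, kbd ρ n :=
  tsum_of_norm_bounded (kbd_summable h0 h1).hasSum (kterm_bound h0 h1 w hw)

lemma kk_continuousOn {ρ : ℝ} (h0 : 0 ≤ ρ) (h1 : ρ < 1) :
    ContinuousOn kk (Metric.closedBall 0 ρ) := by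
  unfold kk
  refine continuousOn_tsum (u := kbd ρ) (fun n => ?_) (kbd_summable h0 h1) (fun n w hw => ?_)
  · refine ContinuousOn.div (by fun_prop) (by fun_prop) (fun w hw => ?_)
    intro h
    have hw' : ‖w‖ ≤ ρ := by simpa using hw
    have e : ‖w^2‖ = ‖((n:ℂ) + 1)^2‖ := by rw [sub_eq_zero.1 h]
    have e2 : ‖((n:ℂ) + 1)^2‖ = ((n:ℝ)+1)^2 := by
      rw [norm_pow]; congr 1
      have : ((n:ℂ)+1) = (((n:ℝ)+1 : ℝ) : ℂ) := by push_cast; rfl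
      rw [this, Complex.norm_real, Real.norm_of_nonneg (by positivity)]
    rw [e2, norm_pow] at e
    have := kden_pos h0 h1 n
    have : ‖w‖^2 ≤ ρ^2 := by gcongr
    linarith
  · exact kterm_bound h0 h1 w (by simpa using hw) n

lemma kk_continuousAt (w : ℂ) (hw : ‖w‖ < 1) : ContinuousAt kk w := by
  obtain ⟨ρ, h1, h2⟩ := exists_between hw
  refine (kk_continuousOn ((norm_nonneg w).trans h1.le) h2).continuousAt ?_
  exact Filter.mem_of_superset (Metric.isOpen_ball.mem_nhds (by simpa using h1))
    Metric.ball_subset_closedBall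

lemma kk_ofReal (u : ℝ) : kk u = -((kr u : ℝ) : ℂ) := by
  unfold kk kr
  rw [Complex.ofReal_tsum, ← tsum_neg]
  congr 1
  ext n
  push_cast
  ring

lemma kr_summable (u : ℝ) (hu : |u| < 1) : Summable (fun n : ℕ => (2 * u) / (((n:ℝ) + 1)^2 - u^2)) := by
  refine Summable.of_norm_bounded (kbd_summable (abs_nonneg u) hu) (fun n => ?_)
  have := kterm_bound (abs_nonneg u) hu (u:ℂ) (by simp) n
  rw [neg_div, norm_neg] at this
  rw [← Complex.norm_real]
  push_cast
  exact this

lemma kk_eq_cot (w : ℂ) (hw : 0 < w.im) : kk w = Real.pi * Complex.cot (Real.pi * w) - 1 / w := by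
  have hz : w ∈ Complex.integerComplement := by
    rintro ⟨n, hn⟩
    rw [← hn] at hw
    simp at hw
  rw [cot_series_rep' hz]
  unfold kk
  congr 1
  ext n
  rw [show 1 / (w - (↑n + 1)) + 1 / (w + (↑n + 1)) = _ from cotTerm_identity hz n, mul_one_div, neg_div, ← div_neg]
  congr 1
  ring

lemma kr_pair (a b u v : ℝ) (ha : 0 ≤ a) (hab : a ≤ b) (hv : |v| ≤ u) (hbu : b * u < 1) :
    0 ≤ (b * kr (b * v) - a * kr (a * v)) + (b * kr (b * u) - a * kr (a * u)) := by
  have hu : 0 ≤ u := (abs_nonneg v).trans hv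
  have hb : 0 ≤ b := ha.trans hab
  have hau : a * u < 1 := by nlinarith
  have hbv : |b * v| < 1 := by rw [abs_mul, abs_of_nonneg hb]; nlinarith
  have hav : |a * v| < 1 := by rw [abs_mul, abs_of_nonneg ha]; nlinarith
  have s1 := (kr_summable (b*v) hbv).mul_left b
  have s2 := (kr_summable (a*v) hav).mul_left a
  have s3 := (kr_summable (b*u) (by rw [abs_of_nonneg (by positivity)]; exact hbu)).mul_left b
  have s4 := (kr_summable (a*u) (by rw [abs_of_nonneg (by positivity)]; exact hau)).mul_left a
  unfold kr
  rw [← tsum_mul_left, ← tsum_mul_left, ← tsum_mul_left, ← tsum_mul_left, ← s1.tsum_sub s2,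
    ← s3.tsum_sub s4, ← (s1.sub s2).tsum_add (s3.sub s4)]
  refine tsum_nonneg (fun n => ?_)
  set N : ℝ := (n:ℝ) + 1 with hN
  have hN1 : 1 ≤ N := by simp [hN]
  have d1 : 0 < N^2 - (b*u)^2 := by nlinarith [mul_nonneg hb hu]
  have d2 : 0 < N^2 - (a*u)^2 := by nlinarith [mul_nonneg ha hu]
  have hvu : v^2 ≤ u^2 := sq_le_sq' (by linarith [neg_abs_le v]) ((le_abs_self v).trans hv)
  have l1 : N^2 - (b*u)^2 ≤ N^2 - (b*v)^2 := by nlinarith [mul_le_mul_of_nonneg_left hvu (sq_nonneg b)]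
  have l2 : N^2 - (a*u)^2 ≤ N^2 - (a*v)^2 := by nlinarith [mul_le_mul_of_nonneg_left hvu (sq_nonneg a)]
  have d3 := d1.trans_le l1
  have d4 := d2.trans_le l2
  have key : ∀ t : ℝ, 0 < N^2 - (b*t)^2 → 0 < N^2 - (a*t)^2 →
    b * (2 * (b * t) / (N^2 - (b*t)^2)) - a * (2 * (a * t) / (N^2 - (a*t)^2))
      = (2 * N^2 * (b^2 - a^2)) * (t * (1 / ((N^2 - (b*t)^2) * (N^2 - (a*t)^2)))) := by
    intro t h1 h2
    have e : ∀ P Q : ℝ, P ≠ 0 → Q ≠ 0 → b * (2 * (b * t) / P) - a * (2 * (a * t) / Q)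
        = (2 * t * (b^2 * Q - a^2 * P)) * (1 / (P * Q)) := by
      intro P Q hP hQ
      field_simp
    rw [e _ _ h1.ne' h2.ne']
    ring
  rw [key v d3 d4, key u d1 d2, ← mul_add]
  have hba : 0 ≤ b^2 - a^2 := by nlinarith
  refine mul_nonneg (by positivity) ?_
  have q1 : 1 / ((N^2 - (b*v)^2) * (N^2 - (a*v)^2)) ≤ 1 / ((N^2 - (b*u)^2) * (N^2 - (a*u)^2)) :=
    one_div_le_one_div_of_le (by positivity) (mul_le_mul l1 l2 d2.le d3.le)
  have q0 : 0 ≤ 1 / ((N^2 - (b*v)^2) * (N^2 - (a*v)^2)) := by positivity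
  have := neg_abs_le v
  nlinarith [mul_le_mul_of_nonneg_left q1 hu, mul_nonneg (show 0 ≤ v + u by linarith) q0]

end Part2
section Part3
open Filter Topology

noncomputable def Aser (F : ℝ → ℝ) (δ : ℝ) (w : ℂ) : ℂ :=
  ∑' n : ℕ, FT F (δ * (n + 1)) * Complex.exp (2 * Real.pi * Complex.I * (n + 1) * (δ * w))

noncomputable def Pint (F : ℝ → ℝ) (w : ℂ) : ℂ :=
  ∫ t in Set.Ioi (0:ℝ), FT F t * Complex.exp (2 * Real.pi * Complex.I * t * w)

lemma memA.integrable {F : ℝ → ℝ} (hF : memA F) : Integrable F :=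
  hF.1.integrable_of_hasCompactSupport (HasCompactSupport.intro isCompact_Icc hF.2.2.2.1)

lemma memA.integrable_mul {F : ℝ → ℝ} (hF : memA F) (g : ℝ → ℂ)
    (hg : ContinuousOn g (Set.Icc (-(1/2)) (1/2))) : Integrable (fun y => (F y : ℂ) * g y) := by
  rw [← integrableOn_iff_integrable_of_support_subset (s := Set.Icc (-(1/2) : ℝ) (1/2))]
  · apply ContinuousOn.integrableOn_compact isCompact_Icc
    exact (Complex.continuous_ofReal.comp hF.1).continuousOn.mul hg
  · intro y hy
    by_contra h
    apply hy
    simp [hF.2.2.2.1 y h]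

lemma exp_norm_aux (s y : ℝ) (w : ℂ) : ‖Complex.exp (2 * Real.pi * Complex.I * s * (w - y))‖
    = Real.exp (-(2 * Real.pi * w.im) * s) := by
  rw [Complex.norm_exp]
  congr 1
  simp
  ring

lemma Aser_eq (F : ℝ → ℝ) (hF : memA F) (δ : ℝ) (hδ : 0 < δ) (w : ℂ) (hw : 0 < w.im) :
    Aser F δ w = ∫ y : ℝ, (F y : ℂ) * (-1/2 + Complex.I / 2 * Complex.cot (Real.pi * (δ * (w - y)))) := by
  have hpi := Real.pi_pos
  have h1 : ∀ n : ℕ, FT F (δ * (n + 1)) * Complex.exp (2 * Real.pi * Complex.I * (n + 1) * (δ * w))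
      = ∫ y : ℝ, (F y : ℂ) * Complex.exp (2 * Real.pi * Complex.I * (δ * (n + 1) : ℝ) * (w - y)) := by
    intro n
    unfold FT
    rw [← integral_mul_const]
    congr 1
    ext y
    rw [mul_assoc, ← Complex.exp_add]
    congr 2
    push_cast
    ring
  unfold Aser
  simp_rw [h1]
  rw [integral_tsum_of_summable_integral_norm]
  · congr 1
    ext y
    rw [tsum_mul_left]
    congr 1
    set q := Complex.exp (2 * Real.pi * Complex.I * (δ * (w - y))) with hq
    have hqn : ‖q‖ < 1 := by
      rw [hq, Complex.norm_exp, Real.exp_lt_one_iff]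
      simp
      positivity
    have e : ∀ n : ℕ, Complex.exp (2 * Real.pi * Complex.I * (δ * (n + 1) : ℝ) * (w - y)) = q * q ^ n := by
      intro n
      rw [← pow_succ', hq, ← Complex.exp_nat_mul]
      congr 1
      push_cast
      ring
    simp_rw [e]
    rw [tsum_mul_left, tsum_geometric_of_norm_lt_one hqn, Complex.cot_pi_eq_exp_ratio, ← hq]
    have hq1 : 1 - q ≠ 0 := by
      intro h
      rw [← sub_eq_zero.1 h] at hqn
      simp at hqn
    have hI := Complex.I_ne_zero
    field_simp
    ring
  · intro n
    refine hF.integrable_mul _ (Continuous.continuousOn (by fun_prop))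
  · have e : ∀ n : ℕ, (∫ y : ℝ, ‖(F y : ℂ) * Complex.exp (2 * Real.pi * Complex.I * (δ * (n + 1) : ℝ) * (w - y))‖)
       = (∫ y, ‖F y‖) * Real.exp (-(2 * Real.pi * w.im) * δ) * (Real.exp (-(2 * Real.pi * w.im) * δ))^n := by
      intro n
      simp_rw [norm_mul, exp_norm_aux, Complex.norm_real]
      rw [integral_mul_const, mul_assoc (∫ y, ‖F y‖), ← pow_succ', ← Real.exp_nat_mul]
      congr 2
      push_cast
      ring
    simp_rw [e]
    apply Summable.mul_left
    apply summable_geometric_of_lt_one (Real.exp_pos _).le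
    rw [Real.exp_lt_one_iff]
    have : 0 < 2 * Real.pi * w.im * δ := by positivity
    linarith

lemma Pint_eq (F : ℝ → ℝ) (hF : memA F) (w : ℂ) (hw : 0 < w.im) :
    Pint F w = ∫ y : ℝ, (F y : ℂ) * (Complex.I / (2 * Real.pi) * (1 / (w - y))) := by
  have hpi := Real.pi_pos
  have h1 : ∀ t : ℝ, FT F t * Complex.exp (2 * Real.pi * Complex.I * t * w)
      = ∫ y : ℝ, (F y : ℂ) * Complex.exp (2 * Real.pi * Complex.I * t * (w - y)) := by
    intro t
    unfold FT
    rw [← integral_mul_const]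
    congr 1
    ext y
    rw [mul_assoc, ← Complex.exp_add]
    congr 2
    ring
  unfold Pint
  simp_rw [h1]
  have hI : Integrable (Function.uncurry (fun t y : ℝ =>
      (F y : ℂ) * Complex.exp (2 * Real.pi * Complex.I * t * (w - y))))
      ((volume.restrict (Set.Ioi (0:ℝ))).prod volume) := by
    have hexp : Integrable (fun t : ℝ => Real.exp (-(2 * Real.pi * w.im) * t)) (volume.restrict (Set.Ioi (0:ℝ))) :=
      integrableOn_exp_mul_Ioi (by have : 0 < 2 * Real.pi * w.im := by positivity
                                   linarith) 0
    refine (hexp.mul_prod hF.integrable.norm).mono' ?_ ?_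
    · apply Continuous.aestronglyMeasurable
      have := hF.1
      unfold Function.uncurry
      fun_prop
    · refine Eventually.of_forall (fun p => ?_)
      simp only [Function.uncurry]
      rw [norm_mul, exp_norm_aux, Complex.norm_real, mul_comm]
  rw [integral_integral_swap hI]
  congr 1
  ext y
  rw [integral_const_mul]
  congr 1
  have e : ∀ t : ℝ, Complex.exp (2 * Real.pi * Complex.I * t * (w - y)) =
    Complex.exp ((2 * Real.pi * Complex.I * (w - y)) * t) := by
    intro t; congr 1; ring
  simp_rw [e]
  rw [integral_exp_mul_complex_Ioi]
  · have hwy : w - y ≠ 0 := by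
      intro h
      have := congrArg Complex.im h
      simp at this
      linarith
    have hI := Complex.I_ne_zero
    have hp : (Real.pi : ℂ) ≠ 0 := by exact_mod_cast hpi.ne'
    simp only [Complex.ofReal_zero, mul_zero, Complex.exp_zero]
    field_simp
    simp
  · simp
    positivity

lemma diff_eq_im (F : ℝ → ℝ) (hF : memA F) (δ : ℝ) (hδ : 0 < δ) (w : ℂ) (hw : 0 < w.im)
    (hs : δ * (‖w‖ + 1/2) < 1) :
    δ * Aser F δ w - Pint F w = ∫ y : ℝ, (F y : ℂ) *
      (-δ/2 + Complex.I / (2 * Real.pi) * (δ * kk (δ * (w - y)))) := by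
  have hpi := Real.pi_pos
  rw [sub_eq_iff_eq_add, Aser_eq F hF δ hδ w hw, Pint_eq F hF w hw, ← integral_add, ← integral_const_mul]
  · congr 1
    ext y
    rw [kk_eq_cot]
    · have hwy : w - y ≠ 0 := by
        intro h
        have := congrArg Complex.im h
        simp at this
        linarith
      have hp : (Real.pi : ℂ) ≠ 0 := by exact_mod_cast hpi.ne'
      have hd : (δ : ℂ) ≠ 0 := by exact_mod_cast hδ.ne'
      field_simp
      ring
    · simp
      positivity
  · refine hF.integrable_mul _ ?_
    refine continuousOn_const.add (continuousOn_const.mul (continuousOn_const.mul ?_))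
    intro y hy
    have hn : ‖(δ:ℂ) * (w - y)‖ < 1 := by
      rw [norm_mul, Complex.norm_real, Real.norm_of_nonneg hδ.le]
      refine lt_of_le_of_lt ?_ hs
      gcongr
      refine (norm_sub_le _ _).trans ?_
      gcongr
      rw [Complex.norm_real, Real.norm_eq_abs, abs_le]
      exact hy
    exact (ContinuousAt.comp (f := fun y : ℝ => (δ:ℂ) * (w - y)) (kk_continuousAt _ hn)
      (by fun_prop)).continuousWithinAt
  · refine hF.integrable_mul _ (Continuous.continuousOn ?_)
    refine continuous_const.mul (continuous_const.div (by fun_prop) (fun y h => ?_))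
    have := congrArg Complex.im h
    simp at this
    linarith

lemma summable_FT_nat (F : ℝ → ℝ) (hF : memA F) (δ : ℝ) (hδ : 0 < δ) :
    Summable (fun n : ℕ => ‖FT F (δ * (n + 1))‖) := by
  have h := (summable_FT F hF δ hδ).comp_injective (i := fun n : ℕ => (n : ℤ) + 1)
    (fun a b h => by simpa using h)
  refine h.congr (fun n => ?_)
  simp

lemma tendsto_xe (x : ℝ) : Tendsto (fun ε : ℝ => (x:ℂ) + ε * Complex.I) (𝓝[>] 0) (𝓝 (x:ℂ)) := by
  have : Continuous (fun ε : ℝ => (x:ℂ) + ε * Complex.I) := by fun_prop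
  have h := this.tendsto 0
  simp only [Complex.ofReal_zero, zero_mul, add_zero] at h
  exact h.mono_left nhdsWithin_le_nhds

lemma norm_exp_le (s : ℝ) (hs : 0 ≤ s) (w : ℂ) (hw : 0 ≤ w.im) :
    ‖Complex.exp (2 * Real.pi * Complex.I * s * w)‖ ≤ 1 := by
  have := exp_norm_aux s 0 w
  simp only [Complex.ofReal_zero, sub_zero] at this
  rw [this, Real.exp_le_one_iff]
  have : 0 ≤ 2 * Real.pi * w.im * s := by have := Real.pi_pos; positivity
  linarith

lemma tendsto_Aser (F : ℝ → ℝ) (hF : memA F) (δ : ℝ) (hδ : 0 < δ) (x : ℝ) :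
    Tendsto (fun ε : ℝ => Aser F δ (x + ε * Complex.I)) (𝓝[>] 0) (𝓝 (Aser F δ x)) := by
  unfold Aser
  refine tendsto_tsum_of_dominated_convergence (summable_FT_nat F hF δ hδ) (fun n => ?_) ?_
  · refine tendsto_const_nhds.mul ?_
    have : Continuous (fun w : ℂ => Complex.exp (2 * Real.pi * Complex.I * (n + 1) * (δ * w))) := by
      fun_prop
    exact (this.tendsto _).comp (tendsto_xe x)
  · filter_upwards [self_mem_nhdsWithin] with ε hε n
    rw [norm_mul]
    apply mul_le_of_le_one_right (norm_nonneg _)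
    have := norm_exp_le (n+1) (by positivity) (δ * (x + ε * Complex.I)) (by
      simp; exact mul_nonneg hδ.le (le_of_lt hε))
    push_cast at this
    exact this

lemma tendsto_Pint (F : ℝ → ℝ) (hF : memA F) (x : ℝ) :
    Tendsto (fun ε : ℝ => Pint F (x + ε * Complex.I)) (𝓝[>] 0) (𝓝 (Pint F x)) := by
  unfold Pint
  have hi : Integrable (FT F) := hF.2.2.2.2
  refine tendsto_integral_filter_of_dominated_convergence (fun t => ‖FT F t‖) ?_ ?_ hi.norm.integrableOn ?_
  · refine Eventually.of_forall (fun ε => ?_)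
    refine hi.aestronglyMeasurable.restrict.mul (Continuous.aestronglyMeasurable (by fun_prop))
  · filter_upwards [self_mem_nhdsWithin] with ε hε
    refine (ae_restrict_iff' measurableSet_Ioi).2 (Eventually.of_forall (fun t ht => ?_))
    rw [norm_mul]
    apply mul_le_of_le_one_right (norm_nonneg _)
    exact norm_exp_le t (le_of_lt ht) _ (by simpa using le_of_lt hε)
  · refine Eventually.of_forall (fun t => ?_)
    refine tendsto_const_nhds.mul ?_
    have : Continuous (fun w : ℂ => Complex.exp (2 * Real.pi * Complex.I * t * w)) := by
      fun_prop
    exact (this.tendsto _).comp (tendsto_xe x)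

lemma diff_eq (F : ℝ → ℝ) (hF : memA F) (δ : ℝ) (hδ : 0 < δ) (x : ℝ)
    (hs : δ * (|x| + 1/2) < 1) :
    δ * Aser F δ x - Pint F x = ∫ y : ℝ, (F y : ℂ) *
      (-δ/2 + Complex.I / (2 * Real.pi) * (δ * kk (δ * (x - y)))) := by
  have hpi := Real.pi_pos
  obtain ⟨ρ, hρ1, hρ2⟩ := exists_between hs
  have hρ0 : 0 ≤ ρ := le_trans (by positivity) hρ1.le
  have hev : ∀ᶠ ε : ℝ in 𝓝[>] 0, δ * (‖(x:ℂ) + ε * Complex.I‖ + 1/2) < ρ := by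
    have h : Tendsto (fun ε : ℝ => δ * (‖(x:ℂ) + ε * Complex.I‖ + 1/2)) (𝓝[>] 0)
        (𝓝 (δ * (‖(x:ℂ)‖ + 1/2))) := ((tendsto_xe x).norm.add_const _).const_mul _
    refine h.eventually_lt_const ?_
    simpa using hρ1
  have hnorm : ∀ (w : ℂ) (y : ℝ), y ∈ Set.Icc (-(1/2) : ℝ) (1/2) →
      ‖(δ:ℂ) * (w - y)‖ ≤ δ * (‖w‖ + 1/2) := by
    intro w y hy
    rw [norm_mul, Complex.norm_real, Real.norm_of_nonneg hδ.le]
    gcongr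
    refine (norm_sub_le _ _).trans ?_
    gcongr
    rw [Complex.norm_real, Real.norm_eq_abs, abs_le]
    exact hy
  have h1 := ((tendsto_Aser F hF δ hδ x).const_mul (δ:ℂ)).sub (tendsto_Pint F hF x)
  refine tendsto_nhds_unique h1 ?_
  have h2 : Tendsto (fun ε : ℝ => ∫ y : ℝ, (F y : ℂ) *
      (-δ/2 + Complex.I / (2 * Real.pi) * (δ * kk (δ * (x + ε * Complex.I - y))))) (𝓝[>] 0)
      (𝓝 (∫ y : ℝ, (F y : ℂ) * (-δ/2 + Complex.I / (2 * Real.pi) * (δ * kk (δ * (x - y)))))) := by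
    set C : ℝ := ‖(-δ/2 : ℂ)‖ + ‖Complex.I / (2 * Real.pi)‖ * (‖(δ:ℂ)‖ * ∑' n, kbd ρ n)
    refine tendsto_integral_filter_of_dominated_convergence (fun y => ‖F y‖ * C) ?_ ?_
      (hF.integrable.norm.mul_const _) ?_
    · filter_upwards [hev] with ε hε
      refine (hF.integrable_mul _ ?_).aestronglyMeasurable
      refine continuousOn_const.add (continuousOn_const.mul (continuousOn_const.mul ?_))
      intro y hy
      have hn := ((hnorm ((x:ℂ) + ε * Complex.I) y hy).trans_lt hε).trans hρ2
      exact (ContinuousAt.comp (f := fun y : ℝ => (δ:ℂ) * (x + ε * Complex.I - y)) (kk_continuousAt _ hn)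
        (by fun_prop)).continuousWithinAt
    · filter_upwards [hev] with ε hε
      refine Eventually.of_forall (fun y => ?_)
      by_cases hy : y ∈ Set.Icc (-(1/2) : ℝ) (1/2)
      · rw [norm_mul, Complex.norm_real]
        refine mul_le_mul_of_nonneg_left ?_ (norm_nonneg _)
        refine (norm_add_le _ _).trans ?_
        rw [norm_mul, norm_mul]
        have := kk_bound hρ0 hρ2 _ ((hnorm ((x:ℂ) + ε * Complex.I) y hy).trans hε.le)
        exact add_le_add le_rfl (mul_le_mul_of_nonneg_left
          (mul_le_mul_of_nonneg_left this (norm_nonneg _)) (norm_nonneg _))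
      · simp [hF.2.2.2.1 y hy]
    · refine Eventually.of_forall (fun y => ?_)
      by_cases hy : y ∈ Set.Icc (-(1/2) : ℝ) (1/2)
      · refine tendsto_const_nhds.mul (tendsto_const_nhds.add (tendsto_const_nhds.mul
          (tendsto_const_nhds.mul ?_)))
        have hn : ‖(δ:ℂ) * (x - y)‖ < 1 := by
          refine (hnorm x y hy).trans_lt ?_
          simpa using hs
        refine (kk_continuousAt _ hn).tendsto.comp ?_
        exact ((tendsto_xe x).sub_const _).const_mul _
      · simp [hF.2.2.2.1 y hy]
  refine h2.congr' ?_
  filter_upwards [hev, self_mem_nhdsWithin] with ε hε hε0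
  rw [diff_eq_im F hF δ hδ _ (by simpa using hε0) (hε.trans hρ2)]

lemma kr_contOn (δ : ℝ) (hδ : 0 < δ) (x : ℝ) (hs : δ * (|x| + 1/2) < 1) :
    ContinuousOn (fun y : ℝ => kk (δ * (x - y))) (Set.Icc (-(1/2)) (1/2)) := by
  intro y hy
  have hn : ‖(δ:ℂ) * (x - y)‖ < 1 := by
    rw [norm_mul, Complex.norm_real, Real.norm_of_nonneg hδ.le]
    refine lt_of_le_of_lt ?_ hs
    gcongr
    refine (norm_sub_le _ _).trans ?_
    rw [Complex.norm_real, Complex.norm_real, Real.norm_eq_abs, Real.norm_eq_abs]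
    gcongr
    rw [abs_le]
    exact hy
  exact (ContinuousAt.comp (f := fun y : ℝ => (δ:ℂ) * (x - y)) (kk_continuousAt _ hn)
      (by fun_prop)).continuousWithinAt

lemma kr_integrable (F : ℝ → ℝ) (hF : memA F) (δ : ℝ) (hδ : 0 < δ) (x : ℝ)
    (hs : δ * (|x| + 1/2) < 1) : Integrable (fun y => F y * (δ * kr (δ * (x - y)))) := by
  have h := (hF.integrable_mul _ (continuousOn_const.mul (kr_contOn δ hδ x hs) : ContinuousOn
    (fun y : ℝ => (-δ : ℂ) * kk (δ * (x - y))) _)).re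
  refine h.congr (Eventually.of_forall (fun y => ?_))
  have : ((δ:ℂ) * (x - y)) = ((δ * (x - y) : ℝ) : ℂ) := by push_cast; rfl
  rw [RCLike.re_eq_complex_re]
  change Complex.re ((F y : ℂ) * ((-δ : ℂ) * kk (δ * (x - y)))) = _
  rw [this, kk_ofReal, neg_mul_neg, ← Complex.ofReal_mul, ← Complex.ofReal_mul]
  exact Complex.ofReal_re _

/-- main real-variable identity -/
lemma diff_real (F : ℝ → ℝ) (hF : memA F) (δ : ℝ) (hδ : 0 < δ) (x : ℝ)
    (hs : δ * (|x| + 1/2) < 1) :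
    δ * (2 * (Aser F δ x).im) - 2 * (Pint F x).im =
      -(1 / Real.pi) * ∫ y : ℝ, F y * (δ * kr (δ * (x - y))) := by
  have hpi := Real.pi_pos
  have h := congrArg Complex.im (diff_eq F hF δ hδ x hs)
  have hint : Integrable (fun y : ℝ => (F y : ℂ) *
      (-δ/2 + Complex.I / (2 * Real.pi) * (δ * kk (δ * (x - y))))) :=
    hF.integrable_mul _ (continuousOn_const.add (continuousOn_const.mul (continuousOn_const.mul
      (kr_contOn δ hδ x hs))))
  have him : (∫ y : ℝ, (F y : ℂ) *
      (-δ/2 + Complex.I / (2 * Real.pi) * (δ * kk (δ * (x - y))))).im =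
      ∫ y : ℝ, -(1 / (2 * Real.pi)) * (F y * (δ * kr (δ * (x - y)))) := by
    refine (integral_im hint).symm.trans ?_
    congr 1
    ext y
    have e : ((δ:ℂ) * (x - y)) = ((δ * (x - y) : ℝ) : ℂ) := by push_cast; rfl
    rw [e, kk_ofReal]
    have : ((F y : ℂ) * (-δ/2 + Complex.I / (2 * Real.pi) * (δ * -(kr (δ * (x - y)) : ℂ))))
      = ((F y * (-δ/2) : ℝ) : ℂ) + ((-(1 / (2 * Real.pi)) * (F y * (δ * kr (δ * (x - y)))) : ℝ) : ℂ) * Complex.I := by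
      push_cast
      ring
    rw [this]
    rw [RCLike.im_eq_complex_im, Complex.add_im, Complex.ofReal_im, Complex.im_ofReal_mul, Complex.I_im]
    ring
  rw [him, integral_const_mul] at h
  rw [Complex.sub_im, Complex.im_ofReal_mul] at h
  have : δ * (2 * (Aser F δ x).im) - 2 * (Pint F x).im = 2 * (δ * (Aser F δ x).im - (Pint F x).im) := by ring
  rw [this, h]
  ring

end Part3
section Part4
open Filter Topology

lemma FT_neg {F : ℝ → ℝ} (hF : memA F) (t : ℝ) : FT F (-t) = FT F t := by
  unfold FT
  rw [← integral_neg_eq_self]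
  congr 1
  ext x
  rw [hF.2.1 x]
  congr 2
  push_cast
  ring

lemma FT_conj {F : ℝ → ℝ} (hF : memA F) (t : ℝ) : (starRingEnd ℂ) (FT F t) = FT F t := by
  rw [← FT_neg hF t]
  nth_rewrite 1 [FT_neg hF t]
  unfold FT
  rw [← integral_conj]
  congr 1
  ext x
  rw [map_mul, Complex.conj_ofReal, ← Complex.exp_conj]
  congr 2
  simp [map_ofNat]

lemma exp_conj_aux (s θ : ℝ) : (starRingEnd ℂ) (Complex.exp (2 * Real.pi * Complex.I * s * θ))
    = Complex.exp (2 * Real.pi * Complex.I * (-s : ℝ) * θ) := by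
  rw [← Complex.exp_conj]
  congr 1
  simp [map_ofNat]

lemma norm_exp_one (s θ : ℝ) : ‖Complex.exp (2 * Real.pi * Complex.I * s * θ)‖ = 1 := by
  rw [Complex.norm_exp]
  simp

lemma conj_comb (A : ℂ) : -Complex.I * A + Complex.I * (starRingEnd ℂ) A = ((2 * A.im : ℝ) : ℂ) := by
  apply Complex.ext <;> simp
  ring

lemma HilbPer_eq {F : ℝ → ℝ} (hF : memA F) (δ : ℝ) (hδ : 0 < δ) (x : ℝ) :
    HilbPer F δ (δ * x) = ((2 * (Aser F δ x).im : ℝ) : ℂ) := by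
  have hs : Summable (fun n : ℕ => FT F (δ * (n + 1)) *
      Complex.exp (2 * Real.pi * Complex.I * (n + 1) * (δ * x))) := by
    refine Summable.of_norm_bounded (summable_FT_nat F hF δ hδ) (fun n => ?_)
    rw [norm_mul]
    have := norm_exp_one (n+1) (δ * x)
    push_cast at this
    rw [this, mul_one]
  have hA : HasSum _ (Aser F δ x) := hs.hasSum
  have hA2 := Complex.hasSum_conj'.2 hA
  unfold HilbPer
  rw [← conj_comb]
  have := HasSum.of_add_one_of_neg_add_one (f := fun k : ℤ => -Complex.I * (Int.sign k : ℂ) * FT F (δ * k) *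
    Complex.exp (2 * Real.pi * Complex.I * k * (δ * x : ℝ))) (m := -Complex.I * Aser F δ x)
    (m' := Complex.I * (starRingEnd ℂ) (Aser F δ x)) ?_ ?_
  · rw [this.tsum_eq]; simp
  · refine ((congrArg (fun g : ℕ → ℂ => HasSum g _) (funext fun n => ?_)).mp (hA.mul_left (-Complex.I)))
    have h1 : Int.sign ((n:ℤ) + 1) = 1 := Int.sign_eq_one_of_pos (by positivity)
    simp only [h1]
    push_cast
    ring
  · refine ((congrArg (fun g : ℕ → ℂ => HasSum g _) (funext fun n => ?_)).mp (hA2.mul_left Complex.I))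
    have h1 : Int.sign (-((n:ℤ) + 1)) = -1 := Int.sign_eq_neg_one_of_neg (by lia)
    have h2 := exp_conj_aux (n+1) (δ * x)
    push_cast at h2
    simp only [h1, map_mul (starRingEnd ℂ) (FT F _), FT_conj hF, h2]
    push_cast
    rw [show δ * -((n:ℝ) + 1) = -(δ * (n+1)) by ring, FT_neg hF]
    ring

lemma HilbR_eq {F : ℝ → ℝ} (hF : memA F) (x : ℝ) :
    HilbR F x = ((2 * (Pint F x).im : ℝ) : ℂ) := by
  have hi : Integrable (FT F) := hF.2.2.2.2
  have hg : Integrable (fun t : ℝ => -Complex.I * (Real.sign t : ℂ) * FT F t *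
      Complex.exp (2 * Real.pi * Complex.I * t * x)) := by
    have h1 : Integrable (fun t : ℝ => FT F t * Complex.exp (2 * Real.pi * Complex.I * t * x)) := by
      refine hi.mul_bdd (c := 1) (Continuous.aestronglyMeasurable (by fun_prop)) ?_
      exact Eventually.of_forall (fun t => (norm_exp_one t x).le)
    have hm : Measurable Real.sign := by
      unfold Real.sign
      refine Measurable.ite measurableSet_Iio measurable_const ?_
      exact Measurable.ite measurableSet_Ioi measurable_const measurable_const
    have h2 : Integrable (fun t : ℝ => (-Complex.I * (Real.sign t : ℂ)) *
        (FT F t * Complex.exp (2 * Real.pi * Complex.I * t * x))) := by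
      refine h1.bdd_mul (c := 1) ?_ ?_
      · exact (measurable_const.mul (Complex.measurable_ofReal.comp hm)).aestronglyMeasurable
      · refine Eventually.of_forall (fun t => ?_)
        rcases Real.sign_apply_eq t with h | h | h <;> simp [h]
    refine h2.congr (Eventually.of_forall (fun t => ?_))
    simp only
    ring
  unfold HilbR
  rw [← intervalIntegral.integral_Iic_add_Ioi hg.integrableOn hg.integrableOn (b := 0)]
  rw [← conj_comb, add_comm]
  congr 1
  · unfold Pint
    rw [← integral_const_mul]
    refine setIntegral_congr_fun measurableSet_Ioi (fun t ht => ?_)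
    simp only [Real.sign_of_pos ht]
    push_cast
    ring
  · have := integral_comp_neg_Ioi 0 (fun t : ℝ => -Complex.I * (Real.sign t : ℂ) * FT F t *
      Complex.exp (2 * Real.pi * Complex.I * t * x))
    rw [neg_zero] at this
    rw [← this]
    unfold Pint
    rw [← integral_conj, ← integral_const_mul]
    refine setIntegral_congr_fun measurableSet_Ioi (fun t ht => ?_)
    have ht' : -t < 0 := by simpa using ht
    simp only [Real.sign_of_neg ht', map_mul, FT_conj hF, FT_neg hF, exp_conj_aux]
    push_cast
    ring

lemma HilbPer_continuous {F : ℝ → ℝ} (hF : memA F) (δ : ℝ) (hδ : 0 < δ) :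
    Continuous (HilbPer F δ) := by
  unfold HilbPer
  refine continuous_tsum (fun k => by fun_prop) (summable_FT F hF δ hδ) (fun k θ => ?_)
  have := norm_exp_one k θ
  push_cast at this
  rw [norm_mul, norm_mul, norm_mul, this, mul_one, norm_neg, Complex.norm_I, one_mul]
  refine mul_le_of_le_one_left (norm_nonneg _) ?_
  rcases Int.sign_trichotomy k with h | h | h <;> simp [h]

lemma HilbPer_bound {F : ℝ → ℝ} (hF : memA F) (δ : ℝ) (hδ : 0 < δ) (θ : ℝ) :
    ‖HilbPer F δ θ‖ ≤ ∑' k : ℤ, ‖FT F (δ * k)‖ := by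
  unfold HilbPer
  refine tsum_of_norm_bounded (summable_FT F hF δ hδ).hasSum (fun k => ?_)
  have := norm_exp_one k θ
  push_cast at this
  rw [norm_mul, norm_mul, norm_mul, this, mul_one, norm_neg, Complex.norm_I, one_mul]
  refine mul_le_of_le_one_left (norm_nonneg _) ?_
  rcases Int.sign_trichotomy k with h | h | h <;> simp [h]

lemma HilbR_bound {F : ℝ → ℝ} (hF : memA F) (x : ℝ) : ‖HilbR F x‖ ≤ ∫ t, ‖FT F t‖ := by
  unfold HilbR
  have hi : Integrable (FT F) := hF.2.2.2.2
  refine norm_integral_le_of_norm_le hi.norm (Eventually.of_forall (fun t => ?_))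
  rw [norm_mul, norm_mul, norm_mul, norm_exp_one, mul_one, norm_neg, Complex.norm_I, one_mul]
  refine mul_le_of_le_one_left (norm_nonneg _) ?_
  rcases Real.sign_apply_eq t with h | h | h <;> simp [h]

lemma HilbPer_neg {F : ℝ → ℝ} (hF : memA F) (δ θ : ℝ) : HilbPer F δ (-θ) = -HilbPer F δ θ := by
  unfold HilbPer
  rw [← (Equiv.neg ℤ).tsum_eq, ← tsum_neg]
  congr 1
  ext k
  simp only [Equiv.neg_apply, Int.sign_neg]
  push_cast
  rw [show δ * -(k:ℝ) = -(δ * k) by ring, FT_neg hF,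
    show (2 * Real.pi * Complex.I * -(k:ℂ) * -(θ:ℂ)) = 2 * Real.pi * Complex.I * k * θ by ring]
  ring

lemma HilbPer_sub_int (F : ℝ → ℝ) (δ θ : ℝ) (m : ℤ) : HilbPer F δ (θ - m) = HilbPer F δ θ := by
  unfold HilbPer
  congr 1
  ext k
  congr 1
  rw [Complex.exp_eq_exp_iff_exists_int]
  refine ⟨-(k * m), ?_⟩
  push_cast
  ring

lemma HilbPer_half {F : ℝ → ℝ} (hF : memA F) (δ : ℝ) : HilbPer F δ (1/2) = 0 := by
  have h1 := HilbPer_sub_int F δ (1/2) 1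
  have h2 := HilbPer_neg hF δ (1/2)
  rw [show (1/2 - ((1:ℤ):ℝ) : ℝ) = -(1/2) by norm_num, h2] at h1
  exact self_eq_neg.1 h1.symm

lemma sym_nonneg {F : ℝ → ℝ} (hF : memA F) (D : ℝ → ℝ) (x : ℝ)
    (hi : Integrable (fun y => F y * D (x - y)))
    (hD : ∀ y ∈ Set.Icc (-(1/2) : ℝ) (1/2), 0 ≤ D (x - y) + D (x + y)) :
    0 ≤ ∫ y, F y * D (x - y) := by
  have h1 : ∫ y, F y * D (x + y) = ∫ y, F y * D (x - y) := by
    rw [← integral_neg_eq_self]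
    congr 1
    ext y
    rw [hF.2.1 y, sub_eq_add_neg]
  have hi2 : Integrable (fun y => F y * D (x + y)) := by
    refine hi.comp_neg.congr (Eventually.of_forall (fun y => ?_))
    simp only [hF.2.1 y, sub_neg_eq_add]
  have h2 : 0 ≤ ∫ y, (F y * D (x - y) + F y * D (x + y)) := by
    refine integral_nonneg (fun y => ?_)
    by_cases hy : y ∈ Set.Icc (-(1/2) : ℝ) (1/2)
    · simp only [Pi.zero_apply, ← mul_add]
      exact mul_nonneg (hF.2.2.1 y) (hD y hy)
    · simp [hF.2.2.2.1 y hy]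
  rw [integral_add hi hi2, h1] at h2
  linarith

noncomputable def GG (F : ℝ → ℝ) (δ x : ℝ) : ℝ := δ * (2 * (Aser F δ x).im)
noncomputable def HH (F : ℝ → ℝ) (x : ℝ) : ℝ := 2 * (Pint F x).im

lemma pair_aux (a b x y : ℝ) (ha : 0 ≤ a) (hab : a ≤ b) (hx : 0 ≤ x) (hs : b * (x + 1/2) < 1)
    (hy : y ∈ Set.Icc (-(1/2) : ℝ) (1/2)) :
    0 ≤ (b * kr (b * (x - y)) - a * kr (a * (x - y))) + (b * kr (b * (x + y)) - a * kr (a * (x + y))) := by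
  have hb := ha.trans hab
  rcases le_total 0 y with h | h
  · exact kr_pair a b (x + y) (x - y) ha hab (abs_le.2 ⟨by linarith, by linarith⟩)
      (lt_of_le_of_lt (mul_le_mul_of_nonneg_left (by linarith [hy.2]) hb) hs)
  · rw [add_comm]
    exact kr_pair a b (x - y) (x + y) ha hab (abs_le.2 ⟨by linarith, by linarith⟩)
      (lt_of_le_of_lt (mul_le_mul_of_nonneg_left (by linarith [hy.1]) hb) hs)

lemma GG_le_HH {F : ℝ → ℝ} (hF : memA F) (b x : ℝ) (hb : 0 < b) (hx : 0 ≤ x)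
    (hs : b * (x + 1/2) < 1) : GG F b x ≤ HH F x := by
  have hs' : b * (|x| + 1/2) < 1 := by rwa [abs_of_nonneg hx]
  have h := diff_real F hF b hb x hs'
  have h2 := sym_nonneg hF (fun u => b * kr (b * u)) x (kr_integrable F hF b hb x hs')
    (fun y hy => by simpa using pair_aux 0 b x y le_rfl hb.le hx hs hy)
  have : 0 ≤ (1 / Real.pi) * ∫ y : ℝ, F y * (b * kr (b * (x - y))) :=
    mul_nonneg (by have := Real.pi_pos; positivity) h2
  unfold GG HH
  linarith

lemma GG_mono {F : ℝ → ℝ} (hF : memA F) (a b x : ℝ) (ha : 0 < a) (hab : a ≤ b) (hx : 0 ≤ x)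
    (hs : b * (x + 1/2) < 1) : GG F b x ≤ GG F a x := by
  have hb := ha.trans_le hab
  have hs' : b * (|x| + 1/2) < 1 := by rwa [abs_of_nonneg hx]
  have hsa : a * (|x| + 1/2) < 1 := lt_of_le_of_lt (by gcongr) hs'
  have h := diff_real F hF b hb x hs'
  have h' := diff_real F hF a ha x hsa
  have i1 := kr_integrable F hF b hb x hs'
  have i2 := kr_integrable F hF a ha x hsa
  have h2 := sym_nonneg hF (fun u => b * kr (b * u) - a * kr (a * u)) x
    ((i1.sub i2).congr (Eventually.of_forall (fun y => by simp [mul_sub])))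
    (fun y hy => pair_aux a b x y ha.le hab hx hs hy)
  simp only [mul_sub (F _)] at h2
  rw [integral_sub i1 i2] at h2
  have : 0 ≤ (1 / Real.pi) * ((∫ y : ℝ, F y * (b * kr (b * (x - y)))) - ∫ y : ℝ, F y * (a * kr (a * (x - y)))) :=
    mul_nonneg (by have := Real.pi_pos; positivity) h2
  unfold GG
  rw [mul_sub] at this
  linarith

lemma norm_HilbR {F : ℝ → ℝ} (hF : memA F) (x : ℝ) : ‖HilbR F x‖ = |HH F x| := by
  rw [HilbR_eq hF, Complex.norm_real, Real.norm_eq_abs, HH]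

lemma norm_HilbPer {F : ℝ → ℝ} (hF : memA F) (δ : ℝ) (hδ : 0 < δ) (x : ℝ) :
    δ * ‖HilbPer F δ (δ * x)‖ = |GG F δ x| := by
  rw [HilbPer_eq hF δ hδ, Complex.norm_real, Real.norm_eq_abs, GG, abs_mul δ, abs_of_pos hδ]

lemma bdd_R {F : ℝ → ℝ} (hF : memA F) : BddAbove (Set.range fun x => ‖HilbR F x‖) :=
  ⟨_, by rintro _ ⟨x, rfl⟩; exact HilbR_bound hF x⟩

lemma bdd_Per {F : ℝ → ℝ} (hF : memA F) (δ : ℝ) (hδ : 0 < δ) :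
    BddAbove (Set.range fun x => ‖HilbPer F δ x‖) :=
  ⟨_, by rintro _ ⟨x, rfl⟩; exact HilbPer_bound hF δ hδ x⟩

lemma GG_bound {F : ℝ → ℝ} (hF : memA F) (δ x : ℝ) (hδ : 0 < δ) (hδ1 : δ ≤ 1) (hx : 0 ≤ x)
    (hx2 : δ * x < 1/2) (hne : x ≠ 1/2) : |GG F δ x| ≤ max (supHR F) (supHPer F 1) := by
  set M := max (supHR F) (supHPer F 1) with hM
  have hR : |HH F x| ≤ M := by
    rw [← norm_HilbR hF]
    exact (le_ciSup (bdd_R hF) x).trans (le_max_left _ _)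
  have hM0 : 0 ≤ M := (abs_nonneg _).trans hR
  have hP : |GG F 1 x| ≤ M := by
    rw [← norm_HilbPer hF 1 one_pos, one_mul]
    exact (le_ciSup (bdd_Per hF 1 one_pos) _).trans (le_max_right _ _)
  have hup : GG F δ x ≤ M :=
    (GG_le_HH hF δ x hδ hx (by linarith)).trans ((le_abs_self _).trans hR)
  refine abs_le.2 ⟨?_, hup⟩
  rcases lt_or_gt_of_ne hne with h | h
  · have := GG_mono hF δ 1 x hδ hδ1 hx (by linarith)
    linarith [neg_abs_le (GG F 1 x)]
  · have hx0 : 0 < x := by linarith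
    have hd : δ ≤ 1 / (2 * x) := by
      rw [le_div_iff₀ (by positivity)]; linarith
    have hs : 1 / (2 * x) * (x + 1/2) < 1 := by
      rw [div_mul_eq_mul_div, one_mul, div_lt_one (by positivity)]; linarith
    have h1 := GG_mono hF δ (1 / (2 * x)) x hδ hd hx hs
    have h2 : GG F (1 / (2 * x)) x = 0 := by
      have := norm_HilbPer hF (1 / (2 * x)) (by positivity) x
      rw [show 1 / (2 * x) * x = 1/2 by field_simp, HilbPer_half hF, norm_zero, mul_zero] at this
      exact abs_eq_zero.1 this.symm
    linarith

lemma Per_bound {F : ℝ → ℝ} (hF : memA F) (δ θ : ℝ) (hδ : 0 < δ) (hδ1 : δ ≤ 1) :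
    δ * ‖HilbPer F δ θ‖ ≤ max (supHR F) (supHPer F 1) := by
  set M := max (supHR F) (supHPer F 1) with hM
  have h0 : ∀ θ, 0 ≤ θ → θ < 1/2 → θ ≠ δ / 2 → δ * ‖HilbPer F δ θ‖ ≤ M := by
    intro θ h1 h2 h3
    have e : δ * (θ / δ) = θ := by field_simp
    have := GG_bound hF δ (θ / δ) hδ hδ1 (by positivity) (by rw [e]; exact h2) (by
      intro h
      apply h3
      rw [← e, h]; ring)
    rwa [← norm_HilbPer hF δ hδ, e] at this
  have hcl : IsClosed {θ : ℝ | δ * ‖HilbPer F δ θ‖ ≤ M} :=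
    isClosed_le (continuous_const.mul (HilbPer_continuous hF δ hδ).norm) continuous_const
  have h1 : δ * ‖HilbPer F δ (δ / 2)‖ ≤ M := by
    have hsub : Set.Ioo 0 (δ/2) ⊆ {θ : ℝ | δ * ‖HilbPer F δ θ‖ ≤ M} := by
      intro θ hθ
      exact h0 θ hθ.1.le (by linarith [hθ.2]) hθ.2.ne
    have := closure_minimal hsub hcl
    rw [closure_Ioo (by positivity)] at this
    exact this ⟨by positivity, le_rfl⟩
  have hM0 : 0 ≤ M := le_trans (by positivity) h1
  have h2 : ∀ θ, 0 ≤ θ → θ ≤ 1/2 → δ * ‖HilbPer F δ θ‖ ≤ M := by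
    intro θ a b
    rcases eq_or_ne θ (δ/2) with h | h
    · rw [h]; exact h1
    rcases b.lt_or_eq with h' | h'
    · exact h0 θ a h' h
    · rw [h', HilbPer_half hF]; simpa using hM0
  have h3 := h2 |θ - round θ| (abs_nonneg _) (abs_sub_round θ)
  rcases abs_choice (θ - round θ) with h | h
  · rw [h, HilbPer_sub_int] at h3; exact h3
  · rw [h, HilbPer_neg hF, HilbPer_sub_int, norm_neg] at h3; exact h3

lemma tendsto_GG {F : ℝ → ℝ} (hF : memA F) (x : ℝ) :
    Tendsto (fun δ => GG F δ x) (𝓝[>] 0) (𝓝 (HH F x)) := by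
  have hpi := Real.pi_pos
  rw [tendsto_iff_norm_sub_tendsto_zero]
  set C := ∑' n, kbd (1/2) n
  have hlim : Tendsto (fun δ : ℝ => (1 / Real.pi) * ∫ y, F y * (δ * C)) (𝓝[>] 0) (𝓝 0) := by
    simp_rw [integral_mul_const]
    have : Continuous (fun δ : ℝ => (1 / Real.pi) * ((∫ y, F y) * (δ * C))) := by fun_prop
    have h := this.tendsto 0
    simp only [zero_mul, mul_zero] at h
    exact h.mono_left nhdsWithin_le_nhds
  have hev : ∀ᶠ δ : ℝ in 𝓝[>] 0, δ * (|x| + 1/2) < 1/2 := by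
    have : Continuous (fun δ : ℝ => δ * (|x| + 1/2)) := by fun_prop
    have h := this.tendsto 0
    rw [zero_mul] at h
    exact (h.mono_left nhdsWithin_le_nhds).eventually_lt_const (by norm_num)
  refine tendsto_of_tendsto_of_tendsto_of_le_of_le' tendsto_const_nhds hlim
    (Eventually.of_forall (fun _ => norm_nonneg _)) ?_
  filter_upwards [hev, self_mem_nhdsWithin] with δ h1 h2
  have hδ : 0 < δ := h2
  unfold GG HH
  rw [diff_real F hF δ hδ x (by linarith), norm_mul, norm_neg, Real.norm_of_nonneg (by positivity : 0 ≤ 1 / Real.pi)]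
  refine mul_le_mul_of_nonneg_left ?_ (by positivity)
  refine norm_integral_le_of_norm_le (hF.integrable.mul_const _) (Eventually.of_forall (fun y => ?_))
  by_cases hy : y ∈ Set.Icc (-(1/2) : ℝ) (1/2)
  · rw [norm_mul, Real.norm_of_nonneg (hF.2.2.1 y), norm_mul, Real.norm_of_nonneg hδ.le]
    refine mul_le_mul_of_nonneg_left (mul_le_mul_of_nonneg_left ?_ hδ.le) (hF.2.2.1 y)
    have hk := kk_bound (ρ := 1/2) (by norm_num) (by norm_num) ((δ * (x - y) : ℝ) : ℂ) (by
      rw [Complex.norm_real, norm_mul, Real.norm_of_nonneg hδ.le, Real.norm_eq_abs]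
      refine le_trans (mul_le_mul_of_nonneg_left ?_ hδ.le) h1.le
      refine (abs_sub _ _).trans ?_
      gcongr
      exact abs_le.2 hy)
    rwa [kk_ofReal, norm_neg, Complex.norm_real] at hk
  · simp [hF.2.2.2.1 y hy]

end Part4

/-- Key proposition: the supremum over `0 < δ ≤ 1` of `δ·‖𝓗(f_δ)‖_{L∞(ℝ/ℤ)}` equals
`max{‖𝓗(F)‖_{L∞(ℝ)}, ‖𝓗(f_1)‖_{L∞(ℝ/ℤ)}}`. -/
theorem stmt6 (F : ℝ → ℝ) (hF : memA F) (hFint : ∫ x : ℝ, F x = 1) :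
    (⨆ δ : Set.Ioc (0:ℝ) 1, (δ : ℝ) * supHPer F δ) = max (supHR F) (supHPer F 1) := by
  have hup : ∀ δ : Set.Ioc (0:ℝ) 1, (δ : ℝ) * supHPer F δ ≤ max (supHR F) (supHPer F 1) := by
    rintro ⟨δ, h0, h1⟩
    have : supHPer F δ ≤ max (supHR F) (supHPer F 1) / δ := by
      refine ciSup_le (fun θ => ?_)
      rw [le_div_iff₀ h0, mul_comm]
      exact Per_bound hF δ θ h0 h1
    rw [le_div_iff₀ h0, mul_comm] at this
    exact this
  have hbdd : BddAbove (Set.range fun δ : Set.Ioc (0:ℝ) 1 => (δ : ℝ) * supHPer F δ) :=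
    ⟨_, by rintro _ ⟨δ, rfl⟩; exact hup δ⟩
  have : Nonempty (Set.Ioc (0:ℝ) 1) := ⟨⟨1, by norm_num, le_rfl⟩⟩
  refine le_antisymm (ciSup_le hup) (max_le ?_ ?_)
  · refine ciSup_le (fun x => ?_)
    rw [norm_HilbR hF]
    refine le_of_tendsto (tendsto_GG hF x).abs ?_
    filter_upwards [Ioc_mem_nhdsGT (zero_lt_one' ℝ)] with δ hδ
    rw [← norm_HilbPer hF δ hδ.1]
    refine le_trans ?_ (le_ciSup hbdd ⟨δ, hδ⟩)
    exact mul_le_mul_of_nonneg_left (le_ciSup (bdd_Per hF δ hδ.1) _) hδ.1.le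
  · have := le_ciSup hbdd ⟨1, by norm_num, le_rfl⟩
    simpa using this
end

section
/- Let F ∈ 𝒜, 0 < δ ≤ 1, and −1/2 < θ < 1/2. Then δ·𝓗(f_δ)(θ) = 𝓗(F)(θ/δ) + (δ/π)·Σ_{k≥1} ∫₀^{δ/2} f_δ(α) · [4θ(θ² − α² − k²)] / [((θ − α)² − k²)·((θ + α)² − k²)] dα. -/
open MeasureTheory

/-- The periodization `f_δ(α) = Σ_{k∈ℤ} F_δ(α+k)` of `F_δ(x) = δ⁻¹F(x/δ)`. -/
noncomputable def perio (F : ℝ → ℝ) (δ : ℝ) (α : ℝ) : ℝ :=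
  ∑' k : ℤ, (1 / δ) * F ((α + k) / δ)


theorem h7_FT_eq (G : ℝ → ℝ) : FT G = FourierTransform.fourier (fun x : ℝ => (G x : ℂ)) := by
  ext t
  rw [Real.fourier_eq']
  unfold FT
  congr 1
  ext x
  rw [smul_eq_mul, mul_comm]
  congr 2
  simp
  ring

theorem h7_swap (f g : ℝ → ℂ) (hf : Integrable f) (hg : Integrable g) (u : ℝ → ℝ → ℂ)
    (hu : Continuous (Function.uncurry u)) (hb : ∀ x t, ‖u x t‖ ≤ 1) :
    ∫ x, f x * ∫ t, g t * u x t = ∫ t, g t * ∫ x, f x * u x t := by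
  have h1 : Integrable (Function.uncurry (fun x t => f x * (g t * u x t)))
      ((volume : Measure ℝ).prod (volume : Measure ℝ)) := by
    have h := (hf.mul_prod hg).bdd_mul (f := Function.uncurry u) (c := 1)
      hu.aestronglyMeasurable (Filter.Eventually.of_forall (fun p => hb p.1 p.2))
    refine h.congr (Filter.Eventually.of_forall (fun p => ?_))
    simp [Function.uncurry]
    ring
  have h2 := integral_integral_swap h1
  simp_rw [integral_const_mul] at h2
  rw [h2]
  congr 1
  ext t
  rw [← integral_const_mul]
  congr 1
  ext x
  ring

theorem h7_norm_e (a b : ℝ) : ‖Complex.exp (2 * Real.pi * Complex.I * a * b)‖ = 1 := by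
  rw [show (2 * Real.pi * Complex.I * a * b : ℂ) = ((2 * Real.pi * a * b : ℝ) : ℂ) * Complex.I by
    push_cast; ring]
  exact Complex.norm_exp_ofReal_mul_I _

theorem h7_norm_e' (a b : ℝ) : ‖Complex.exp (-(2 * Real.pi * Complex.I) * a * b)‖ = 1 := by
  rw [show (-(2 * Real.pi * Complex.I) * a * b : ℂ)
    = ((-(2 * Real.pi * a * b) : ℝ) : ℂ) * Complex.I by
    push_cast; ring]
  exact Complex.norm_exp_ofReal_mul_I _

theorem h7_integrable (G : ℝ → ℝ) (hc : Continuous G)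
    (hs : ∀ x : ℝ, x ∉ Set.Icc (-(1/2) : ℝ) (1/2) → G x = 0) :
    Integrable (fun x => (G x : ℂ)) := by
  apply Integrable.ofReal
  exact hc.integrable_of_hasCompactSupport (HasCompactSupport.intro isCompact_Icc hs)

theorem h7_inv (G : ℝ → ℝ) (hc : Continuous G)
    (hs : ∀ x : ℝ, x ∉ Set.Icc (-(1/2) : ℝ) (1/2) → G x = 0) (hi : Integrable (FT G)) (x : ℝ) :
    (G x : ℂ) = ∫ s, FT G s * Complex.exp (2 * Real.pi * Complex.I * s * x) := by
  have h := Continuous.fourierInv_fourier_eq (f := fun x => (G x : ℂ)) (by fun_prop)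
    (h7_integrable G hc hs) (by rw [← h7_FT_eq]; exact hi)
  rw [← h7_FT_eq] at h
  have h2 := congrFun h x
  rw [Real.fourierInv_eq'] at h2
  rw [← h2]
  congr 1
  ext s
  rw [smul_eq_mul, mul_comm]
  congr 2
  simp
  ring

theorem h7_conv (G : ℝ → ℝ) (hc : Continuous G)
    (hs : ∀ x : ℝ, x ∉ Set.Icc (-(1/2) : ℝ) (1/2) → G x = 0) (hi : Integrable (FT G))
    (c : ℝ → ℝ) (hci : Integrable (fun x => (c x : ℂ))) (hc1 : ∀ x ∈ Set.Icc (-(1/2) : ℝ) (1/2), c x = 1) (t : ℝ) :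
    FT G t = ∫ s, FT G s * FT c (t - s) := by
  have hE : Integrable (fun x : ℝ => (c x : ℂ) * Complex.exp (-(2 * Real.pi * Complex.I) * t * x)) := by
    have := hci.bdd_mul (f := fun x : ℝ => Complex.exp (-(2 * Real.pi * Complex.I) * t * x))
      (c := 1) (by fun_prop) (Filter.Eventually.of_forall (fun x => (h7_norm_e' t x).le))
    exact this.congr (Filter.Eventually.of_forall (fun x => mul_comm _ _))
  have h := h7_swap _ _ hE hi (fun x s => Complex.exp (2 * Real.pi * Complex.I * s * x))
    (by unfold Function.uncurry; fun_prop) (fun x s => (h7_norm_e s x).le)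
  calc FT G t = ∫ x, (c x : ℂ) * Complex.exp (-(2 * Real.pi * Complex.I) * t * x) *
        ∫ s, FT G s * Complex.exp (2 * Real.pi * Complex.I * s * x) := by
        conv_lhs => unfold FT
        congr 1
        ext x
        rw [← h7_inv G hc hs hi x]
        by_cases hx : x ∈ Set.Icc (-(1/2) : ℝ) (1/2)
        · rw [hc1 x hx]; simp; ring
        · rw [hs x hx]; simp
    _ = _ := by
        rw [h]
        congr 1
        ext s
        congr 1
        conv_rhs => unfold FT
        congr 1
        ext x
        rw [mul_assoc, ← Complex.exp_add]
        congr 2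
        push_cast
        ring

theorem h7_bump : ∃ (c : ℝ → ℝ) (C : ℝ), Integrable (fun x => (c x : ℂ)) ∧ 0 ≤ C ∧ 
    (∀ x ∈ Set.Icc (-(1/2) : ℝ) (1/2), c x = 1) ∧ Continuous (FT c) ∧ 
    ∀ u, ‖FT c u‖ ≤ C / (1 + u ^ 2) := by
  let b : ContDiffBump (0:ℝ) := ⟨1, 2, by norm_num, by norm_num⟩
  have hb1 : HasCompactSupport (fun x => ((b x : ℝ) : ℂ)) := by
    exact b.hasCompactSupport.comp_left (g := fun y : ℝ => (y : ℂ)) (by simp)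
  have hb2 : ContDiff ℝ (⊤ : ℕ∞) (fun x => ((b x : ℝ) : ℂ)) :=
    Complex.ofRealCLM.contDiff.comp b.contDiff
  let S : SchwartzMap ℝ ℂ := hb1.toSchwartzMap hb2
  have hS : ((FourierTransform.fourier S : SchwartzMap ℝ ℂ) : ℝ → ℂ) = FT b := by
    rw [h7_FT_eq, SchwartzMap.fourier_coe]
    rfl
  obtain ⟨C0, h0, hC0⟩ := (FourierTransform.fourier S : SchwartzMap ℝ ℂ).decay 0 0
  obtain ⟨C2, h2, hC2⟩ := (FourierTransform.fourier S : SchwartzMap ℝ ℂ).decay 2 0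
  rw [hS] at hC0 hC2
  refine ⟨b, C0 + C2, S.integrable, by positivity, ?_, ?_, ?_⟩
  · intro x hx
    apply b.one_of_mem_closedBall
    simp only [Metric.mem_closedBall, dist_zero_right, Real.norm_eq_abs]
    change |x| ≤ 1
    rw [abs_le]
    constructor <;> linarith [hx.1, hx.2]
  · rw [← hS]; exact SchwartzMap.continuous _
  · intro u
    rw [le_div_iff₀ (by positivity)]
    have a0 := hC0 u
    have a2 := hC2 u
    simp only [pow_zero, one_mul, norm_iteratedFDeriv_zero, Real.norm_eq_abs, sq_abs] at a0 a2
    linarith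

theorem h7_sum_bound (s : ℝ) (T : Finset ℤ) :
    ∑ k ∈ T, 1 / (1 + ((k : ℝ) - s) ^ 2) ≤ ∑' k : ℤ, 3 / (1 + (k : ℝ) ^ 2) := by
  have hsum : Summable (fun k : ℤ => 3 / (1 + (k : ℝ) ^ 2)) := by
    have h : Summable (fun k : ℤ => 3 * (1 / (k : ℝ) ^ 2)) :=
      ((Real.summable_one_div_int_pow (p := 2)).mpr (by norm_num)).mul_left 3
    refine Summable.of_norm_bounded_eventually h ?_
    have : ({0}ᶜ : Set ℤ) ∈ Filter.cofinite := (Set.finite_singleton (0:ℤ)).compl_mem_cofinite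
    filter_upwards [this] with k hk
    have hk' : (k : ℝ) ≠ 0 := by exact_mod_cast hk
    have hk2 : 0 < (k : ℝ) ^ 2 := by positivity
    rw [Real.norm_eq_abs, abs_of_nonneg (by positivity), mul_one_div]
    gcongr
    linarith
  have hinj : Function.Injective (fun k : ℤ => k - ⌊s⌋) := sub_left_injective
  calc ∑ k ∈ T, 1 / (1 + ((k : ℝ) - s) ^ 2) ≤ ∑ k ∈ T, 3 / (1 + (((k - ⌊s⌋ : ℤ) : ℝ)) ^ 2) := by
        apply Finset.sum_le_sum
        intro k _
        rw [div_le_div_iff₀ (by positivity) (by positivity)]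
        push_cast
        have h1 := Int.floor_le s
        have h2 := Int.lt_floor_add_one s
        nlinarith [sq_nonneg ((k:ℝ) - ⌊s⌋ - 2 * (s - ⌊s⌋)), sq_nonneg ((k:ℝ) - ⌊s⌋ + 2 * (s - ⌊s⌋)), sq_nonneg ((k:ℝ) - s)]
    _ = ∑ k ∈ T.image (fun k : ℤ => k - ⌊s⌋), 3 / (1 + (k : ℝ) ^ 2) := by
        rw [Finset.sum_image (fun a _ b _ h => hinj h)]
    _ ≤ _ := hsum.sum_le_tsum _ (fun k _ => by positivity)

theorem h7_summable (G : ℝ → ℝ) (hc : Continuous G)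
    (hs : ∀ x : ℝ, x ∉ Set.Icc (-(1/2) : ℝ) (1/2) → G x = 0) (hi : Integrable (FT G)) :
    Summable (fun k : ℤ => ‖FT G k‖) := by
  obtain ⟨c, C, hci, hC, hc1, hcc, hcb⟩ := h7_bump
  have hint : ∀ k : ℤ, Integrable (fun s => ‖FT G s‖ * (C * (1 / (1 + ((k:ℝ) - s) ^ 2)))) := by
    intro k
    have := hi.norm.bdd_mul (f := fun s => C * (1 / (1 + ((k:ℝ) - s) ^ 2)))
      (c := C) (by 
        apply Continuous.aestronglyMeasurable
        refine continuous_const.mul (continuous_const.div (by fun_prop) (fun x => by positivity)))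
      (Filter.Eventually.of_forall (fun x => by
        rw [Real.norm_eq_abs, abs_of_nonneg (by positivity)]
        have : 1 / (1 + ((k:ℝ) - x) ^ 2) ≤ 1 := by
          rw [div_le_one (by positivity)]
          nlinarith [sq_nonneg ((k:ℝ) - x)]
        nlinarith))
    exact this.congr (Filter.Eventually.of_forall (fun x => mul_comm _ _))
  refine summable_of_sum_le (c := ∫ s, ‖FT G s‖ * (C * ∑' k : ℤ, 3 / (1 + (k : ℝ) ^ 2))) (fun k => norm_nonneg _) ?_
  intro T
  calc ∑ k ∈ T, ‖FT G k‖ ≤ ∑ k ∈ T, ∫ s, ‖FT G s‖ * (C * (1 / (1 + ((k:ℝ) - s) ^ 2))) := by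
        apply Finset.sum_le_sum
        intro k _
        rw [h7_conv G hc hs hi c hci hc1 k]
        apply norm_integral_le_of_norm_le (hint k)
        refine Filter.Eventually.of_forall (fun s => ?_)
        rw [norm_mul]
        gcongr
        rw [mul_one_div]
        exact hcb _
    _ = ∫ s, ∑ k ∈ T, ‖FT G s‖ * (C * (1 / (1 + ((k:ℝ) - s) ^ 2))) := by
        rw [integral_finsetSum _ (fun k _ => hint k)]
    _ ≤ _ := by
        apply integral_mono (integrable_finsetSum _ (fun k _ => hint k)) (hi.norm.mul_const _)
        intro s
        simp only
        rw [← Finset.mul_sum, ← Finset.mul_sum]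
        gcongr
        exact h7_sum_bound s T

theorem h7_norm_q (w : ℂ) (hw : 0 < w.im) : ‖Complex.exp (2 * Real.pi * Complex.I * w)‖ < 1 := by
  rw [Complex.norm_exp, Real.exp_lt_one_iff]
  simp
  positivity

theorem h7_geom (w : ℂ) (hw : 0 < w.im) :
    HasSum (fun n : ℕ => -Complex.I * Complex.exp (2 * Real.pi * Complex.I * w) ^ (n + 1))
      ((Complex.cot (Real.pi * w) + Complex.I) / 2) := by
  have hq := h7_norm_q w hw
  rw [Complex.cot_pi_eq_exp_ratio]
  set q := Complex.exp (2 * Real.pi * Complex.I * w) with hqd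
  have hq1 : 1 - q ≠ 0 := by
    intro h
    have : q = 1 := by linear_combination -h
    rw [this] at hq
    simp at hq
  have h := (hasSum_geometric_of_norm_lt_one hq).mul_left (-Complex.I * q)
  have hv : ((q + 1) / (Complex.I * (1 - q)) + Complex.I) / 2 = -Complex.I * q * (1 - q)⁻¹ := by
    have hI := Complex.I_ne_zero
    field_simp
    linear_combination (1 + q) * Complex.I_sq
  rw [hv]
  refine h.congr_fun ?_
  intro n
  ring

theorem h7_S (ε : ℝ) (hε : 0 < ε) (x : ℝ) :
    HasSum (fun k : ℤ => -Complex.I * (Int.sign k : ℂ) * Real.exp (-(2 * Real.pi * ε) * |(k:ℝ)|) *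
      Complex.exp (2 * Real.pi * Complex.I * k * x))
      ((Complex.cot (Real.pi * (x + ε * Complex.I)) + Complex.cot (Real.pi * (x - ε * Complex.I))) / 2) := by
  have h1 := h7_geom (x + ε * Complex.I) (by simpa using hε)
  have h2 := (h7_geom (-(x - ε * Complex.I)) (by simpa using hε)).neg
  have hcn : Complex.cot (Real.pi * -(x - ε * Complex.I)) = - Complex.cot (Real.pi * (x - ε * Complex.I)) := by
    rw [mul_neg]
    simp only [Complex.cot, Complex.cos_neg, Complex.sin_neg, div_neg]
  rw [hcn] at h2
  have := HasSum.of_add_one_of_neg_add_one (f := fun k : ℤ => -Complex.I * (Int.sign k : ℂ) * Real.exp (-(2 * Real.pi * ε) * |(k:ℝ)|) *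
      Complex.exp (2 * Real.pi * Complex.I * k * x)) (m := (Complex.cot (Real.pi * (x + ε * Complex.I)) + Complex.I) / 2)
      (m' := - ((- Complex.cot (Real.pi * (x - ε * Complex.I)) + Complex.I) / 2)) ?_ ?_
  · convert this using 1
    simp
    ring
  · refine h1.congr_fun ?_
    intro n
    have e1 : Int.sign ((n:ℤ) + 1) = 1 := Int.sign_eq_one_of_pos (by positivity)
    have e2 : |(((n:ℤ) + 1 : ℤ) : ℝ)| = (n:ℝ) + 1 := by
      push_cast; exact abs_of_nonneg (by positivity)
    rw [e1, e2, ← Complex.exp_nat_mul, Complex.ofReal_exp, mul_assoc, ← Complex.exp_add]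
    push_cast
    rw [mul_one]
    congr 2
    linear_combination (-(2 * Real.pi * (n + 1) * ε : ℂ)) * Complex.I_sq
  · refine h2.congr_fun ?_
    intro n
    have e1 : Int.sign (-((n:ℤ) + 1)) = -1 := Int.sign_eq_neg_one_of_neg (by omega)
    have e2 : |((-((n:ℤ) + 1) : ℤ) : ℝ)| = (n:ℝ) + 1 := by
      push_cast; rw [abs_neg]; exact abs_of_nonneg (by positivity)
    rw [e1, e2, ← Complex.exp_nat_mul, Complex.ofReal_exp, mul_assoc, ← Complex.exp_add]
    push_cast
    have key : ∀ u v : ℂ, u = v → -Complex.I * -1 * Complex.exp u = -(-Complex.I * Complex.exp v) := by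
      rintro u v rfl
      ring
    apply key
    linear_combination (-(2 * Real.pi * (n + 1) * ε : ℂ)) * Complex.I_sq

theorem h7_T (ε : ℝ) (hε : 0 < ε) (x : ℝ) :
    Integrable (fun t : ℝ => -Complex.I * (Real.sign t : ℂ) * Real.exp (-(2 * Real.pi * ε) * |t|) *
      Complex.exp (2 * Real.pi * Complex.I * t * x)) ∧
    ∫ t : ℝ, -Complex.I * (Real.sign t : ℂ) * Real.exp (-(2 * Real.pi * ε) * |t|) *
      Complex.exp (2 * Real.pi * Complex.I * t * x) =
      (1 / (x + ε * Complex.I) + 1 / (x - ε * Complex.I)) / (2 * Real.pi) := by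
  set f : ℝ → ℂ := fun t : ℝ => -Complex.I * (Real.sign t : ℂ) * Real.exp (-(2 * Real.pi * ε) * |t|) *
      Complex.exp (2 * Real.pi * Complex.I * t * x) with hf
  have hpi := Real.pi_pos
  set a : ℂ := 2 * Real.pi * Complex.I * (x + ε * Complex.I) with ha
  set b : ℂ := 2 * Real.pi * Complex.I * (x - ε * Complex.I) with hb
  have ha0 : a.re < 0 := by simp [ha]; positivity
  have hb0 : 0 < b.re := by simp [hb]; positivity
  have e1 : Set.EqOn f (fun t : ℝ => -Complex.I * Complex.exp (a * t)) (Set.Ioi 0) := by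
    intro t ht
    have ht' : 0 < t := ht
    simp only [hf]
    rw [Real.sign_of_pos ht', abs_of_pos ht', Complex.ofReal_exp, mul_assoc, ← Complex.exp_add]
    push_cast
    rw [mul_one]
    congr 2
    rw [ha]
    linear_combination (-(2 * Real.pi * t * ε : ℂ)) * Complex.I_sq
  have e2' : Set.EqOn f (fun t : ℝ => Complex.I * Complex.exp (b * t)) (Set.Iio 0) := by
    intro t ht
    have ht' : t < 0 := ht
    simp only [hf]
    rw [Real.sign_of_neg ht', abs_of_neg ht', Complex.ofReal_exp, mul_assoc, ← Complex.exp_add]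
    push_cast
    congr 1
    · ring
    congr 1
    rw [hb]
    linear_combination ((2 * Real.pi * t * ε : ℂ)) * Complex.I_sq
  have e2 : f =ᵐ[volume.restrict (Set.Iic 0)] (fun t : ℝ => Complex.I * Complex.exp (b * t)) := by
    rw [← Measure.restrict_congr_set Iio_ae_eq_Iic]
    exact (ae_restrict_iff' measurableSet_Iio).mpr (Filter.Eventually.of_forall e2')
  have i1 : IntegrableOn f (Set.Ioi 0) :=
    IntegrableOn.congr_fun ((integrableOn_exp_mul_complex_Ioi ha0 0).const_mul _) e1.symm measurableSet_Ioi
  have i2 : IntegrableOn f (Set.Iic 0) :=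
    Integrable.congr ((integrableOn_exp_mul_complex_Iic hb0 0).const_mul _) e2.symm
  refine ⟨?_, ?_⟩
  · rw [← integrableOn_univ, ← Set.Iic_union_Ioi (a := (0:ℝ))]
    exact i2.union i1
  · rw [← intervalIntegral.integral_Iic_add_Ioi i2 i1, setIntegral_congr_fun measurableSet_Ioi e1,
      integral_congr_ae e2, integral_const_mul, integral_const_mul,
      integral_exp_mul_complex_Ioi ha0, integral_exp_mul_complex_Iic hb0]
    have hz1 : (x + ε * Complex.I : ℂ) ≠ 0 := by
      intro h; have := congrArg Complex.im h; simp at this; exact hε.ne' this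
    have hz2 : (x - ε * Complex.I : ℂ) ≠ 0 := by
      intro h; have := congrArg Complex.im h; simp at this; exact hε.ne' this
    have hp : (Real.pi : ℂ) ≠ 0 := by exact_mod_cast hpi.ne'
    have hI := Complex.I_ne_zero
    simp only [Complex.ofReal_zero, mul_zero, Complex.exp_zero]
    rw [ha, hb]
    field_simp
    ring

noncomputable def h7_d (n : ℕ) (z : ℂ) : ℂ := 1 / (z - (n + 1)) + 1 / (z + (n + 1))

noncomputable def h7_D (z : ℂ) : ℂ := ∑' n : ℕ, h7_d n z

def h7_strip (b : ℝ) : Set ℂ := {z : ℂ | |z.re| ≤ b ∧ |z.im| ≤ 1}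

theorem h7_lower (b : ℝ) (hb0 : 0 ≤ b) (hb : b < 1) (z : ℂ) (hz : z ∈ h7_strip b) (n : ℕ) :
    (1 - b) * (n + 1) ≤ ‖z - (n + 1)‖ ∧ (1 - b) * (n + 1) ≤ ‖z + (n + 1)‖ := by
  have h1 := abs_le.mp hz.1
  have hn : (0:ℝ) ≤ n := Nat.cast_nonneg n
  constructor
  · have h := Complex.abs_re_le_norm (z - (n + 1))
    refine le_trans ?_ h
    simp
    rw [abs_sub_comm]
    refine le_trans ?_ (le_abs_self _)
    nlinarith
  · have h := Complex.abs_re_le_norm (z + (n + 1))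
    refine le_trans ?_ h
    simp
    refine le_trans ?_ (le_abs_self _)
    nlinarith

theorem h7_ne (b : ℝ) (hb0 : 0 ≤ b) (hb : b < 1) (z : ℂ) (hz : z ∈ h7_strip b) (n : ℕ) :
    z - (n + 1) ≠ 0 ∧ z + (n + 1) ≠ 0 := by
  have h := h7_lower b hb0 hb z hz n
  have hp : 0 < (1 - b) * ((n:ℝ) + 1) := mul_pos (by linarith) (by positivity)
  exact ⟨norm_pos_iff.mp (lt_of_lt_of_le hp h.1), norm_pos_iff.mp (lt_of_lt_of_le hp h.2)⟩

noncomputable def h7_u (b : ℝ) (n : ℕ) : ℝ := 4 / (1 - b) ^ 2 * (1 / ((n:ℝ) + 1) ^ 2)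

theorem h7_u_nonneg (b : ℝ) (n : ℕ) : 0 ≤ h7_u b n := by unfold h7_u; positivity

theorem h7_u_summable (b : ℝ) : Summable (h7_u b) := by
  have h := (summable_nat_add_iff 1).mpr (Real.summable_one_div_nat_pow.mpr (by norm_num : 1 < 2))
  unfold h7_u
  apply Summable.mul_left
  refine h.congr ?_
  intro n
  push_cast
  rfl

theorem h7_d_bound (b : ℝ) (hb0 : 0 ≤ b) (hb : b < 1) (z : ℂ) (hz : z ∈ h7_strip b) (n : ℕ) :
    ‖h7_d n z‖ ≤ h7_u b n := by
  obtain ⟨l1, l2⟩ := h7_lower b hb0 hb z hz n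
  obtain ⟨n1, n2⟩ := h7_ne b hb0 hb z hz n
  have hp : 0 < (1 - b) * ((n:ℝ) + 1) := mul_pos (by linarith) (by positivity)
  have e : h7_d n z = 2 * z / ((z - (n + 1)) * (z + (n + 1))) := by
    unfold h7_d
    field_simp
    ring
  have hz2 : ‖z‖ ≤ 2 := by
    have := Complex.norm_le_abs_re_add_abs_im z
    linarith [hz.1, hz.2]
  rw [e, norm_div, norm_mul, norm_mul]
  have : h7_u b n = 4 / (((1 - b) * ((n:ℝ) + 1)) * ((1 - b) * ((n:ℝ) + 1))) := by
    unfold h7_u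
    have : 1 - b ≠ 0 := by linarith
    field_simp
  rw [this]
  have h2 : ‖(2:ℂ)‖ = 2 := by simp
  rw [h2]
  gcongr
  linarith

theorem h7_D_cont (b : ℝ) (hb0 : 0 ≤ b) (hb : b < 1) : ContinuousOn h7_D (h7_strip b) := by
  unfold h7_D
  refine continuousOn_tsum (fun n => ?_) (h7_u_summable b) (fun n z hz => h7_d_bound b hb0 hb z hz n)
  unfold h7_d
  apply ContinuousOn.add
  · exact continuousOn_const.div (by fun_prop) (fun z hz => (h7_ne b hb0 hb z hz n).1)
  · exact continuousOn_const.div (by fun_prop) (fun z hz => (h7_ne b hb0 hb z hz n).2)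

theorem h7_D_bound (b : ℝ) (hb0 : 0 ≤ b) (hb : b < 1) (z : ℂ) (hz : z ∈ h7_strip b) :
    ‖h7_D z‖ ≤ ∑' n, h7_u b n :=
  tsum_of_norm_bounded (h7_u_summable b).hasSum (fun n => h7_d_bound b hb0 hb z hz n)

theorem h7_cot (z : ℂ) (hz : z.im ≠ 0) : Complex.cot (Real.pi * z) = (1 / z + h7_D z) / Real.pi := by
  have hz' : z ∈ Complex.integerComplement := by
    rintro ⟨n, rfl⟩
    simp at hz
  have h := cot_series_rep' hz'
  have hp : (Real.pi : ℂ) ≠ 0 := by exact_mod_cast Real.pi_pos.ne'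
  unfold h7_D h7_d
  rw [← h]
  field_simp
  ring

noncomputable def h7_Sk (ε : ℝ) (k : ℤ) (x : ℝ) : ℂ :=
  -Complex.I * (Int.sign k : ℂ) * Real.exp (-(2 * Real.pi * ε) * |(k:ℝ)|) *
      Complex.exp (2 * Real.pi * Complex.I * k * x)

noncomputable def h7_Tk (ε : ℝ) (t : ℝ) (x : ℝ) : ℂ :=
  -Complex.I * (Real.sign t : ℂ) * Real.exp (-(2 * Real.pi * ε) * |t|) *
      Complex.exp (2 * Real.pi * Complex.I * t * x)

theorem h7_diff (ε : ℝ) (hε : 0 < ε) (x : ℝ) :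
    ∑' k, h7_Sk ε k x - ∫ t, h7_Tk ε t x =
      (h7_D (x + ε * Complex.I) + h7_D (x - ε * Complex.I)) / (2 * Real.pi) := by
  have h1 := (h7_S ε hε x).tsum_eq
  have h2 := (h7_T ε hε x).2
  unfold h7_Sk h7_Tk
  rw [h1, h2, h7_cot _ (by simpa using hε.ne'), h7_cot _ (by simpa using hε.ne')]
  have hp : (Real.pi : ℂ) ≠ 0 := by exact_mod_cast Real.pi_pos.ne'
  field_simp
  ring

theorem h7_Sk_norm (ε : ℝ) (k : ℤ) (x : ℝ) : ‖h7_Sk ε k x‖ = ‖h7_Sk ε k 0‖ := by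
  unfold h7_Sk
  have h1 := h7_norm_e k x
  have h2 := h7_norm_e k 0
  push_cast at h1 h2 ⊢
  rw [norm_mul, h1, norm_mul _ (Complex.exp (2 * Real.pi * Complex.I * k * 0)), h2]

theorem h7_Sk_summable (ε : ℝ) (hε : 0 < ε) : Summable (fun k => ‖h7_Sk ε k 0‖) :=
  (h7_S ε hε 0).summable.norm

theorem h7_Sk_cont (ε : ℝ) (k : ℤ) : Continuous (h7_Sk ε k) := by
  unfold h7_Sk; fun_prop

theorem h7_S_cont (ε : ℝ) (hε : 0 < ε) : Continuous (fun x => ∑' k, h7_Sk ε k x) :=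
  continuous_tsum (h7_Sk_cont ε) (h7_Sk_summable ε hε) (fun k x => (h7_Sk_norm ε k x).le)

theorem h7_T_cont (ε : ℝ) (hε : 0 < ε) : Continuous (fun x => ∫ t, h7_Tk ε t x) := by
  have : (fun x => ∫ t, h7_Tk ε t x) = fun x : ℝ => 
      (1 / (x + ε * Complex.I) + 1 / (x - ε * Complex.I)) / (2 * Real.pi) := by
    ext x
    exact (h7_T ε hε x).2
  rw [this]
  have hz1 : ∀ x : ℝ, (x + ε * Complex.I : ℂ) ≠ 0 := by
    intro x h; have := congrArg Complex.im h; simp at this; exact hε.ne' this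
  have hz2 : ∀ x : ℝ, (x - ε * Complex.I : ℂ) ≠ 0 := by
    intro x h; have := congrArg Complex.im h; simp at this; exact hε.ne' this
  apply Continuous.div_const
  exact (continuous_const.div (by fun_prop) hz1).add (continuous_const.div (by fun_prop) hz2)

theorem h7_A (G : ℝ → ℝ) (hG : Integrable (fun x => (G x : ℂ))) (ε : ℝ) (hε : 0 < ε) (θ : ℝ) :
    ∑' k : ℤ, (-Complex.I * (Int.sign k : ℂ) * FT G k *
      Complex.exp (2 * Real.pi * Complex.I * k * θ)) * Real.exp (-(2 * Real.pi * ε) * |(k:ℝ)|) =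
    ∫ α : ℝ, (G α : ℂ) * ∑' k, h7_Sk ε k (θ - α) := by
  have e1 : ∀ k : ℤ, (-Complex.I * (Int.sign k : ℂ) * FT G k *
      Complex.exp (2 * Real.pi * Complex.I * k * θ)) * Real.exp (-(2 * Real.pi * ε) * |(k:ℝ)|) =
      ∫ α : ℝ, (G α : ℂ) * h7_Sk ε k (θ - α) := by
    intro k
    have : ∀ α : ℝ, (G α : ℂ) * h7_Sk ε k (θ - α) = 
       (-Complex.I * (Int.sign k : ℂ) * Complex.exp (2 * Real.pi * Complex.I * k * θ) *
         Real.exp (-(2 * Real.pi * ε) * |(k:ℝ)|)) * 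
        ((G α : ℂ) * Complex.exp (-(2 * Real.pi * Complex.I) * (k:ℝ) * α)) := by
      intro α
      have : Complex.exp (2 * Real.pi * Complex.I * k * ((θ - α : ℝ):ℂ)) = 
        Complex.exp (2 * Real.pi * Complex.I * k * θ) * 
          Complex.exp (-(2 * Real.pi * Complex.I) * (k:ℝ) * α) := by
        rw [← Complex.exp_add]
        congr 1
        push_cast
        ring
      unfold h7_Sk
      rw [this]
      ring
    simp_rw [this]
    rw [integral_const_mul]
    unfold FT
    ring
  simp_rw [e1]
  have hn : ∀ (k : ℤ) (α : ℝ), ‖(G α : ℂ) * h7_Sk ε k (θ - α)‖ = ‖h7_Sk ε k 0‖ * ‖(G α : ℂ)‖ := by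
    intro k α
    rw [norm_mul, h7_Sk_norm, mul_comm]
  rw [integral_tsum_of_summable_integral_norm]
  · congr 1
    ext α
    rw [tsum_mul_left]
  · intro k
    have := hG.bdd_mul (f := fun α => h7_Sk ε k (θ - α)) (c := ‖h7_Sk ε k 0‖)
      (((h7_Sk_cont ε k).comp (by fun_prop)).aestronglyMeasurable)
      (Filter.Eventually.of_forall (fun α => (h7_Sk_norm ε k _).le))
    exact this.congr (Filter.Eventually.of_forall (fun x => mul_comm _ _))
  · simp_rw [hn, integral_const_mul]
    exact (h7_Sk_summable ε hε).mul_right _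

theorem h7_B (G : ℝ → ℝ) (hG : Integrable (fun x => (G x : ℂ))) (ε : ℝ) (hε : 0 < ε) (θ : ℝ) :
    ∫ t : ℝ, (-Complex.I * (Real.sign t : ℂ) * FT G t *
      Complex.exp (2 * Real.pi * Complex.I * t * θ)) * Real.exp (-(2 * Real.pi * ε) * |t|) =
    ∫ α : ℝ, (G α : ℂ) * ∫ t, h7_Tk ε t (θ - α) := by
  have h := h7_swap _ _ (h7_T ε hε θ).1 hG
    (fun t α => Complex.exp (-(2 * Real.pi * Complex.I) * t * α))
    (by unfold Function.uncurry; fun_prop) (fun t α => (h7_norm_e' t α).le)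
  calc _ = _ := by
        congr 1
        ext t
        unfold FT
        ring
    _ = _ := h
    _ = _ := by
        congr 1
        ext α
        congr 2
        ext t
        unfold h7_Tk
        rw [mul_assoc, ← Complex.exp_add]
        congr 2
        push_cast
        ring

theorem h7_core (G : ℝ → ℝ) (hc : Continuous G) (a : ℝ) (ha : 0 ≤ a) (ha2 : a ≤ 1 / 2)
    (hs : ∀ x : ℝ, x ∉ Set.Icc (-a) a → G x = 0) (hi : Integrable (FT G))
    (θ : ℝ) (hθ : |θ| + a < 1) :
    ∑' k : ℤ, (-Complex.I * (Int.sign k : ℂ) * FT G k *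
      Complex.exp (2 * Real.pi * Complex.I * k * θ)) -
    ∫ t : ℝ, (-Complex.I * (Real.sign t : ℂ) * FT G t *
      Complex.exp (2 * Real.pi * Complex.I * t * θ)) =
    ∫ α : ℝ, (G α : ℂ) * (h7_D ((θ - α : ℝ) : ℂ) / Real.pi) := by
  have hs' : ∀ x : ℝ, x ∉ Set.Icc (-(1/2) : ℝ) (1/2) → G x = 0 := by
    intro x hx
    apply hs
    intro h
    exact hx ⟨by linarith [h.1], by linarith [h.2]⟩
  have hG := h7_integrable G hc hs'
  have hcs : HasCompactSupport (fun x => (G x : ℂ)) :=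
    HasCompactSupport.intro isCompact_Icc (fun x hx => by rw [hs x hx]; simp)
  have hsum := h7_summable G hc hs' hi
  set b := |θ| + a with hb
  have hb0 : 0 ≤ b := by positivity
  have habs : ∀ α ∈ Set.Icc (-a) a, |θ - α| ≤ b := by
    intro α hα
    have h1 : |α| ≤ a := abs_le.mpr hα
    have := abs_sub θ α
    linarith
  have hexp : ∀ ε > 0, ∀ y : ℝ, ‖((Real.exp (-(2 * Real.pi * ε) * |y|) : ℝ) : ℂ)‖ ≤ 1 := by
    intro ε hε y
    rw [Complex.norm_real, Real.norm_eq_abs, Real.abs_exp, Real.exp_le_one_iff]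
    have : 0 ≤ (2 * Real.pi * ε) * |y| := by have := Real.pi_pos; positivity
    linarith
  have hexpl : ∀ y : ℝ, Filter.Tendsto (fun ε : ℝ => ((Real.exp (-(2 * Real.pi * ε) * |y|) : ℝ) : ℂ))
      (nhdsWithin 0 (Set.Ioi 0)) (nhds 1) := by
    intro y
    have : Continuous (fun ε : ℝ => ((Real.exp (-(2 * Real.pi * ε) * |y|) : ℝ) : ℂ)) := by fun_prop
    have h := this.tendsto 0
    simp only [mul_zero, neg_zero, zero_mul, Real.exp_zero, Complex.ofReal_one] at h
    exact h.mono_left nhdsWithin_le_nhds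
  have hpos : ∀ᶠ ε : ℝ in nhdsWithin 0 (Set.Ioi 0), 0 < ε := self_mem_nhdsWithin
  have hsgnm : Measurable Real.sign := by
    unfold Real.sign
    exact Measurable.ite measurableSet_Iio measurable_const
      (Measurable.ite measurableSet_Ioi measurable_const measurable_const)
  have hsgn : ∀ t : ℝ, ‖(Real.sign t : ℂ)‖ ≤ 1 := by
    intro t
    rcases Real.sign_apply_eq t with h | h | h <;> simp [h]
  have hsgni : ∀ k : ℤ, ‖(Int.sign k : ℂ)‖ ≤ 1 := by
    intro t
    rcases Int.sign_trichotomy t with h | h | h <;> simp [h]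
  have limA : Filter.Tendsto (fun ε : ℝ => ∑' k : ℤ, (-Complex.I * (Int.sign k : ℂ) * FT G k *
      Complex.exp (2 * Real.pi * Complex.I * k * θ)) * Real.exp (-(2 * Real.pi * ε) * |(k:ℝ)|))
      (nhdsWithin 0 (Set.Ioi 0)) (nhds (∑' k : ℤ, (-Complex.I * (Int.sign k : ℂ) * FT G k *
      Complex.exp (2 * Real.pi * Complex.I * k * θ)))) := by
    refine tendsto_tsum_of_dominated_convergence hsum ?_ ?_
    · intro k
      simpa using (hexpl k).const_mul (-Complex.I * (Int.sign k : ℂ) * FT G k *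
        Complex.exp (2 * Real.pi * Complex.I * k * θ))
    · filter_upwards [hpos] with ε hε k
      have h1 := h7_norm_e k θ
      push_cast at h1
      rw [norm_mul, norm_mul, norm_mul, norm_mul, h1, norm_neg, Complex.norm_I, one_mul, mul_one]
      calc _ ≤ 1 * ‖FT G k‖ * 1 := by
            gcongr
            · exact hsgni k
            · exact hexp ε hε k
        _ = _ := by ring
  have limB : Filter.Tendsto (fun ε : ℝ => ∫ t : ℝ, (-Complex.I * (Real.sign t : ℂ) * FT G t *
      Complex.exp (2 * Real.pi * Complex.I * t * θ)) * Real.exp (-(2 * Real.pi * ε) * |t|))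
      (nhdsWithin 0 (Set.Ioi 0)) (nhds (∫ t : ℝ, (-Complex.I * (Real.sign t : ℂ) * FT G t *
      Complex.exp (2 * Real.pi * Complex.I * t * θ)))) := by
    refine tendsto_integral_filter_of_dominated_convergence (fun t => ‖FT G t‖) ?_ ?_ hi.norm ?_
    · refine Filter.Eventually.of_forall (fun ε => ?_)
      have h1 : AEStronglyMeasurable (fun t : ℝ => (Real.sign t : ℂ)) :=
        (Complex.measurable_ofReal.comp hsgnm).aestronglyMeasurable
      have h2 := hi.aestronglyMeasurable
      refine AEStronglyMeasurable.mul (AEStronglyMeasurable.mul (AEStronglyMeasurable.mul (h1.const_mul _) h2) ?_) ?_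
      · exact Continuous.aestronglyMeasurable (by fun_prop)
      · exact Continuous.aestronglyMeasurable (by fun_prop)
    · filter_upwards [hpos] with ε hε
      refine Filter.Eventually.of_forall (fun t => ?_)
      rw [norm_mul, norm_mul, norm_mul, norm_mul, h7_norm_e t θ, norm_neg, Complex.norm_I, one_mul, mul_one]
      calc _ ≤ 1 * ‖FT G t‖ * 1 := by
            gcongr
            · exact hsgn t
            · exact hexp ε hε t
        _ = _ := by ring
    · refine Filter.Eventually.of_forall (fun t => ?_)
      simpa using (hexpl t).const_mul (-Complex.I * (Real.sign t : ℂ) * FT G t *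
        Complex.exp (2 * Real.pi * Complex.I * t * θ))
  have iS : ∀ ε > 0, Integrable (fun α : ℝ => (G α : ℂ) * ∑' k, h7_Sk ε k (θ - α)) := by
    intro ε hε
    refine Continuous.integrable_of_hasCompactSupport ?_ hcs.mul_right
    exact Continuous.mul (by fun_prop) ((h7_S_cont ε hε).comp (by fun_prop))
  have iT : ∀ ε > 0, Integrable (fun α : ℝ => (G α : ℂ) * ∫ t, h7_Tk ε t (θ - α)) := by
    intro ε hε
    refine Continuous.integrable_of_hasCompactSupport ?_ hcs.mul_right
    exact Continuous.mul (by fun_prop) ((h7_T_cont ε hε).comp (by fun_prop))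
  have heq : ∀ ε > 0, ∀ α : ℝ, (G α : ℂ) * ∑' k, h7_Sk ε k (θ - α) - (G α : ℂ) * ∫ t, h7_Tk ε t (θ - α) =
      (G α : ℂ) * ((h7_D (((θ - α : ℝ) : ℂ) + ε * Complex.I) + h7_D (((θ - α : ℝ) : ℂ) - ε * Complex.I)) / (2 * Real.pi)) := by
    intro ε hε α
    rw [← mul_sub, h7_diff ε hε]
  have limC : Filter.Tendsto (fun ε : ℝ => ∫ α : ℝ, (G α : ℂ) * ((h7_D (((θ - α : ℝ) : ℂ) + ε * Complex.I) + h7_D (((θ - α : ℝ) : ℂ) - ε * Complex.I)) / (2 * Real.pi)))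
      (nhdsWithin 0 (Set.Ioi 0)) (nhds (∫ α : ℝ, (G α : ℂ) * (h7_D ((θ - α : ℝ) : ℂ) / Real.pi))) := by
    have hle1 : ∀ᶠ ε : ℝ in nhdsWithin 0 (Set.Ioi 0), ε < 1 :=
      nhdsWithin_le_nhds (Iio_mem_nhds (by norm_num))
    have hin : ∀ α ∈ Set.Icc (-a) a, ∀ ε : ℝ, 0 < ε → ε < 1 →
        (((θ - α : ℝ) : ℂ) + ε * Complex.I) ∈ h7_strip b ∧
        (((θ - α : ℝ) : ℂ) - ε * Complex.I) ∈ h7_strip b := by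
      intro α hα ε h0 h1
      have := habs α hα
      have e2 : |ε| ≤ 1 := by rw [abs_of_pos h0]; exact h1.le
      refine ⟨⟨?_, ?_⟩, ⟨?_, ?_⟩⟩ <;> simp <;> assumption
    have hin0 : ∀ α ∈ Set.Icc (-a) a, ((θ - α : ℝ) : ℂ) ∈ h7_strip b := by
      intro α hα
      have := habs α hα
      refine ⟨?_, ?_⟩ <;> simp
      assumption
    set M := ∑' n, h7_u b n with hM
    refine tendsto_integral_filter_of_dominated_convergence (fun α => ‖(G α : ℂ)‖ * (2 * M / ‖(2 * Real.pi : ℂ)‖)) ?_ ?_ (hG.norm.mul_const _) ?_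
    · filter_upwards [hpos] with ε hε
      have := ((iS ε hε).sub (iT ε hε)).aestronglyMeasurable
      refine this.congr (Filter.Eventually.of_forall (fun α => ?_))
      exact heq ε hε α
    · filter_upwards [hpos, hle1] with ε hε h1
      refine Filter.Eventually.of_forall (fun α => ?_)
      by_cases hα : α ∈ Set.Icc (-a) a
      · rw [norm_mul, norm_div]
        gcongr
        obtain ⟨p, q⟩ := hin α hα ε hε h1
        have := h7_D_bound b hb0 hθ _ p
        have := h7_D_bound b hb0 hθ _ q
        refine (norm_add_le _ _).trans ?_
        linarith
      · rw [hs α hα]; simp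
    · refine Filter.Eventually.of_forall (fun α => ?_)
      by_cases hα : α ∈ Set.Icc (-a) a
      · apply Filter.Tendsto.const_mul
        have hcw := h7_D_cont b hb0 hθ _ (hin0 α hα)
        have t1 : Filter.Tendsto (fun ε : ℝ => ((θ - α : ℝ) : ℂ) + ε * Complex.I) (nhdsWithin 0 (Set.Ioi 0))
            (nhdsWithin ((θ - α : ℝ) : ℂ) (h7_strip b)) := by
          apply tendsto_nhdsWithin_of_tendsto_nhds_of_eventually_within
          · have : Continuous (fun ε : ℝ => ((θ - α : ℝ) : ℂ) + ε * Complex.I) := by fun_prop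
            have h := this.tendsto 0
            simp only [Complex.ofReal_zero, zero_mul, add_zero] at h
            exact h.mono_left nhdsWithin_le_nhds
          · filter_upwards [hpos, hle1] with ε hε h1
            exact (hin α hα ε hε h1).1
        have t2 : Filter.Tendsto (fun ε : ℝ => ((θ - α : ℝ) : ℂ) - ε * Complex.I) (nhdsWithin 0 (Set.Ioi 0))
            (nhdsWithin ((θ - α : ℝ) : ℂ) (h7_strip b)) := by
          apply tendsto_nhdsWithin_of_tendsto_nhds_of_eventually_within
          · have : Continuous (fun ε : ℝ => ((θ - α : ℝ) : ℂ) - ε * Complex.I) := by fun_prop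
            have h := this.tendsto 0
            simp only [Complex.ofReal_zero, zero_mul, sub_zero] at h
            exact h.mono_left nhdsWithin_le_nhds
          · filter_upwards [hpos, hle1] with ε hε h1
            exact (hin α hα ε hε h1).2
        have := ((hcw.tendsto.comp t1).add (hcw.tendsto.comp t2)).div_const (2 * Real.pi : ℂ)
        have e : (h7_D ((θ - α : ℝ) : ℂ) + h7_D ((θ - α : ℝ) : ℂ)) / (2 * Real.pi : ℂ) = h7_D ((θ - α : ℝ) : ℂ) / Real.pi := by
          have hp : (Real.pi : ℂ) ≠ 0 := by exact_mod_cast Real.pi_pos.ne'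
          field_simp
          ring
        rw [e] at this
        exact this
      · rw [hs α hα]; simp
  have limAB := limA.sub limB
  refine tendsto_nhds_unique limAB (limC.congr' ?_)
  filter_upwards [hpos] with ε hε
  rw [h7_A G hG ε hε θ, h7_B G hG ε hε θ, ← integral_sub (iS ε hε) (iT ε hε)]
  congr 1
  ext α
  exact (heq ε hε α).symm

theorem h7_expand (G : ℝ → ℝ) (hc : Continuous G) (a : ℝ) (ha : 0 ≤ a) (ha2 : a ≤ 1 / 2)
    (hs : ∀ x : ℝ, x ∉ Set.Icc (-a) a → G x = 0) (hGe : ∀ x, G (-x) = G x)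
    (θ : ℝ) (hθ : |θ| + a < 1) :
    ∫ α : ℝ, (G α : ℂ) * (h7_D ((θ - α : ℝ) : ℂ) / Real.pi) =
      ((1 / Real.pi * ∑' k : ℕ, ∫ α in (0:ℝ)..a, G α *
          (4 * θ * (θ ^ 2 - α ^ 2 - ((k : ℝ) + 1) ^ 2)) /
          (((θ - α) ^ 2 - ((k : ℝ) + 1) ^ 2) * ((θ + α) ^ 2 - ((k : ℝ) + 1) ^ 2)) : ℝ) : ℂ) := by
  have hb0 : 0 ≤ |θ| + a := by positivity
  have hG : Integrable G := hc.integrable_of_hasCompactSupport (HasCompactSupport.intro isCompact_Icc hs)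
  have habs : ∀ α ∈ Set.Icc (-a) a, |θ - α| ≤ |θ| + a := by
    intro α hα
    have h1 : |α| ≤ a := abs_le.mpr hα
    have := abs_sub θ α
    linarith
  have hin0 : ∀ α ∈ Set.Icc (-a) a, ((θ - α : ℝ) : ℂ) ∈ h7_strip (|θ| + a) := by
    intro α hα
    have := habs α hα
    refine ⟨?_, ?_⟩ <;> simp
    assumption
  set r : ℕ → ℝ → ℝ := fun n x => 1 / (x - (n + 1)) + 1 / (x + (n + 1)) with hr
  have hdr : ∀ n x, h7_d n (x : ℝ) = ((r n x : ℝ) : ℂ) := by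
    intro n x
    simp only [hr, h7_d]
    push_cast
    rfl
  have hbd : ∀ n α, ‖G α * r n (θ - α)‖ ≤ ‖G α‖ * h7_u (|θ| + a) n := by
    intro n α
    by_cases hα : α ∈ Set.Icc (-a) a
    · rw [norm_mul]
      gcongr
      have := h7_d_bound _ hb0 hθ _ (hin0 α hα) n
      rwa [hdr, Complex.norm_real] at this
    · rw [hs α hα]; simp
  have hri : ∀ n, Integrable (fun α => G α * r n (θ - α)) := by
    intro n
    refine Integrable.mono' (hG.norm.mul_const (h7_u (|θ| + a) n)) ?_ (Filter.Eventually.of_forall (hbd n))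
    apply Measurable.aestronglyMeasurable
    simp only [hr]
    have := hc.measurable
    fun_prop
  have hsumm : Summable (fun n => ∫ α, ‖G α * r n (θ - α)‖) := by
    refine Summable.of_nonneg_of_le (fun n => integral_nonneg (fun α => norm_nonneg _)) (fun n => ?_)
      ((h7_u_summable (|θ| + a)).mul_left (∫ α, ‖G α‖))
    rw [← integral_mul_const]
    exact integral_mono (hri n).norm (hG.norm.mul_const _) (hbd n)
  have hsw := integral_tsum_of_summable_integral_norm hri hsumm
  have e1 : ∀ α : ℝ, (G α : ℂ) * (h7_D ((θ - α : ℝ) : ℂ) / Real.pi) =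
      (((1 / Real.pi) * ∑' n, G α * r n (θ - α) : ℝ) : ℂ) := by
    intro α
    unfold h7_D
    simp_rw [hdr]
    rw [← Complex.ofReal_tsum, tsum_mul_left]
    push_cast
    ring
  simp_rw [e1]
  rw [integral_complex_ofReal, integral_const_mul, ← hsw]
  congr 3
  ext n
  have hii : ∀ p q : ℝ, IntervalIntegrable (fun α => G α * r n (θ - α)) volume p q :=
    fun p q => (hri n).intervalIntegrable
  have hset : ∫ α, G α * r n (θ - α) = ∫ α in (-a)..a, G α * r n (θ - α) := by
    rw [intervalIntegral.integral_of_le (by linarith), ← integral_Icc_eq_integral_Ioc,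
      setIntegral_eq_integral_of_forall_compl_eq_zero]
    intro x hx
    rw [hs x hx, zero_mul]
  have hneg : ∫ α in (-a)..0, G α * r n (θ - α) = ∫ α in (0:ℝ)..a, G (-α) * r n (θ - -α) := by
    have := intervalIntegral.integral_comp_neg (a := 0) (b := a) (fun α => G α * r n (θ - α))
    rw [this, neg_zero]
  have hi2 : IntervalIntegrable (fun α => G (-α) * r n (θ - -α)) volume 0 a :=
    (hri n).comp_neg.intervalIntegrable
  rw [hset, ← intervalIntegral.integral_add_adjacent_intervals (hii (-a) 0) (hii 0 a), hneg,
    ← intervalIntegral.integral_add hi2 (hii 0 a)]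
  apply intervalIntegral.integral_congr
  intro α hα
  rw [Set.uIcc_of_le ha] at hα
  have hα1 : α ∈ Set.Icc (-a) a := ⟨by linarith [hα.1], hα.2⟩
  have hα2 : -α ∈ Set.Icc (-a) a := ⟨by linarith [hα.2], by linarith [hα.1]⟩
  obtain ⟨p1, p2⟩ := h7_ne _ hb0 hθ _ (hin0 α hα1) n
  obtain ⟨q1, q2⟩ := h7_ne _ hb0 hθ _ (hin0 (-α) hα2) n
  have p1' : (θ - α) - ((n:ℝ) + 1) ≠ 0 := by exact_mod_cast p1
  have p2' : (θ - α) + ((n:ℝ) + 1) ≠ 0 := by exact_mod_cast p2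
  have q1' : (θ + α) - ((n:ℝ) + 1) ≠ 0 := by rw [sub_neg_eq_add] at q1; exact_mod_cast q1
  have q2' : (θ + α) + ((n:ℝ) + 1) ≠ 0 := by rw [sub_neg_eq_add] at q2; exact_mod_cast q2
  simp only [hr]
  rw [hGe, sub_neg_eq_add]
  rw [show (θ - α) ^ 2 - ((n:ℝ) + 1) ^ 2 = ((θ - α) - ((n:ℝ) + 1)) * ((θ - α) + ((n:ℝ) + 1)) by ring,
    show (θ + α) ^ 2 - ((n:ℝ) + 1) ^ 2 = ((θ + α) - ((n:ℝ) + 1)) * ((θ + α) + ((n:ℝ) + 1)) by ring]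
  field_simp
  ring

/-- Lemma 4: for `F ∈ 𝒜`, `0 < δ ≤ 1` and `-1/2 < θ < 1/2`,
`δ·𝓗(f_δ)(θ) = 𝓗(F)(θ/δ) + (δ/π)·Σ_{k≥1} ∫₀^{δ/2} f_δ(α)·
  4θ(θ²−α²−k²)/(((θ−α)²−k²)((θ+α)²−k²)) dα`. -/
theorem stmt7 (F : ℝ → ℝ) (hF : memA F) (δ : ℝ) (hδ0 : 0 < δ) (hδ1 : δ ≤ 1)
    (θ : ℝ) (hθl : -(1/2) < θ) (hθr : θ < 1/2) :
    (δ : ℂ) * HilbPer F δ θ =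
      HilbR F (θ / δ) +
      ((δ / Real.pi * ∑' k : ℕ, ∫ α in (0:ℝ)..(δ/2), perio F δ α *
          (4 * θ * (θ ^ 2 - α ^ 2 - ((k : ℝ) + 1) ^ 2)) /
          (((θ - α) ^ 2 - ((k : ℝ) + 1) ^ 2) * ((θ + α) ^ 2 - ((k : ℝ) + 1) ^ 2)) : ℝ) : ℂ) := by
  obtain ⟨hc, heven, hnn, hsupp, hint⟩ := hF
  have hδ : δ ≠ 0 := hδ0.ne'
  set G : ℝ → ℝ := fun x => (1 / δ) * F (x / δ) with hG
  have hGc : Continuous G := by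
    rw [hG]; exact continuous_const.mul (hc.comp (continuous_id.div_const _))
  have hGs : ∀ x : ℝ, x ∉ Set.Icc (-(δ / 2)) (δ / 2) → G x = 0 := by
    intro x hx
    simp only [hG]
    rw [hsupp (x / δ), mul_zero]
    rintro ⟨h1, h2⟩
    rw [le_div_iff₀ hδ0] at h1
    rw [div_le_iff₀ hδ0] at h2
    exact hx ⟨by linarith, by linarith⟩
  have hGe : ∀ x, G (-x) = G x := by
    intro x
    simp only [hG]
    rw [neg_div, heven]
  have hFT : ∀ t : ℝ, FT G t = FT F (δ * t) := by
    intro t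
    have h := Measure.integral_comp_div (fun x : ℝ => (F x : ℂ) * Complex.exp (-(2 * Real.pi * Complex.I) * (δ * t : ℝ) * x)) δ
    have hδc : (δ : ℂ) ≠ 0 := by exact_mod_cast hδ
    rw [abs_of_pos hδ0, Complex.real_smul] at h
    unfold FT
    have h' : ∫ x : ℝ, (F x : ℂ) * Complex.exp (-(2 * Real.pi * Complex.I) * (δ * t : ℝ) * x) =
      (1 / δ : ℂ) * (δ * ∫ x : ℝ, (F x : ℂ) * Complex.exp (-(2 * Real.pi * Complex.I) * (δ * t : ℝ) * x)) := by
      field_simp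
    rw [h', ← h, ← integral_const_mul]
    congr 1
    ext x
    simp only [hG]
    push_cast
    rw [mul_assoc]
    congr 3
    field_simp
  have hGi : Integrable (FT G) := by
    have : FT G = fun t => FT F (δ * t) := funext hFT
    rw [this]
    exact hint.comp_mul_left' hδ
  have hb : |θ| + δ / 2 < 1 := by
    have : |θ| < 1 / 2 := abs_lt.mpr ⟨hθl, hθr⟩
    linarith
  have hcore := h7_core G hGc (δ / 2) (by positivity) (by linarith) hGs hGi θ hb
  have hR : HilbR F (θ / δ) = δ * ∫ t : ℝ, (-Complex.I * (Real.sign t : ℂ) * FT G t *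
      Complex.exp (2 * Real.pi * Complex.I * t * θ)) := by
    have h := Measure.integral_comp_mul_left (fun t : ℝ => -Complex.I * (Real.sign t : ℂ) * FT F t * Complex.exp (2 * Real.pi * Complex.I * t * (θ / δ : ℝ))) δ
    rw [abs_of_pos (inv_pos.mpr hδ0), Complex.real_smul] at h
    have hδc : (δ : ℂ) ≠ 0 := by exact_mod_cast hδ
    have e1 : (∫ t : ℝ, (-Complex.I * (Real.sign t : ℂ) * FT G t *
      Complex.exp (2 * Real.pi * Complex.I * t * θ))) = ∫ t : ℝ, -Complex.I * (Real.sign (δ * t) : ℂ) * FT F (δ * t) * Complex.exp (2 * Real.pi * Complex.I * (δ * t : ℝ) * (θ / δ : ℝ)) := by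
      congr 1
      ext t
      have hsg : Real.sign (δ * t) = Real.sign t := by
        rcases lt_trichotomy t 0 with ht | ht | ht
        · rw [Real.sign_of_neg ht, Real.sign_of_neg (mul_neg_of_pos_of_neg hδ0 ht)]
        · rw [ht, mul_zero]
        · rw [Real.sign_of_pos ht, Real.sign_of_pos (mul_pos hδ0 ht)]
      rw [hFT, hsg]
      congr 2
      push_cast
      field_simp
    rw [e1, h]
    unfold HilbR
    rw [← mul_assoc, Complex.ofReal_inv, mul_inv_cancel₀ hδc, one_mul]
  have hP : HilbPer F δ θ = ∑' k : ℤ, (-Complex.I * (Int.sign k : ℂ) * FT G k *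
      Complex.exp (2 * Real.pi * Complex.I * k * θ)) := by
    unfold HilbPer
    simp_rw [hFT]
  have hper : ∀ α ∈ Set.Icc 0 (δ / 2), perio F δ α = G α := by
    have hhalf : F (1 / 2) = 0 := by
      have ht : Filter.Tendsto F (nhdsWithin (1 / 2) (Set.Ioi (1 / 2))) (nhds (F (1 / 2))) :=
        (hc.tendsto _).mono_left nhdsWithin_le_nhds
      refine tendsto_nhds_unique ht (tendsto_const_nhds.congr' ?_)
      filter_upwards [self_mem_nhdsWithin] with y hy
      rw [hsupp y]
      intro h
      exact absurd h.2 (not_le.mpr hy)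
    intro α hα
    unfold perio
    rw [tsum_eq_single 0]
    · simp [hG]
    · intro k hk
      have hz : F ((α + k) / δ) = 0 := by
        rcases lt_or_gt_of_ne hk with h | h
        · have hk1 : (k : ℝ) ≤ -1 := by exact_mod_cast (by omega : k ≤ -1)
          have hle : (α + k) / δ ≤ -(1 / 2) := by
            rw [div_le_iff₀ hδ0]
            linarith [hα.2]
          rcases hle.lt_or_eq with h1 | h1
          · exact hsupp _ (fun hh => absurd hh.1 (not_le.mpr h1))
          · rw [h1, heven, hhalf]
        · have hk1 : (1 : ℝ) ≤ k := by exact_mod_cast (by omega : 1 ≤ k)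
          have hle : 1 / 2 < (α + k) / δ := by
            rw [lt_div_iff₀ hδ0]
            linarith [hα.1]
          exact hsupp _ (fun hh => absurd hh.2 (not_le.mpr hle))
      rw [hz, mul_zero]
  have hD := h7_expand G hGc (δ / 2) (by positivity) (by linarith) hGs hGe θ hb
  have hD2 : ∫ α : ℝ, (G α : ℂ) * (h7_D ((θ - α : ℝ) : ℂ) / Real.pi) =
      ((1 / Real.pi * ∑' k : ℕ, ∫ α in (0:ℝ)..(δ/2), perio F δ α *
          (4 * θ * (θ ^ 2 - α ^ 2 - ((k : ℝ) + 1) ^ 2)) /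
          (((θ - α) ^ 2 - ((k : ℝ) + 1) ^ 2) * ((θ + α) ^ 2 - ((k : ℝ) + 1) ^ 2)) : ℝ) : ℂ) := by
    rw [hD]
    congr 3
    ext k
    apply intervalIntegral.integral_congr
    intro α hα
    rw [Set.uIcc_of_le (by positivity)] at hα
    simp only
    rw [hper α hα]
  rw [hD2] at hcore
  rw [hP, hR]
  have h3 := sub_eq_iff_eq_add.mp hcore
  rw [h3]
  push_cast
  ring
end
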